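/- arXiv:2504.19582 — 3 statements merged into one kernel-verified Lean document; each statement's English description precedes it below -/
import Mathlib

section
/- There is a constant c such that for every integer n ≥ 2 there exists a finite simple graph U of treewidth at most 2 (in particular, U is K_4-minor-free and planar) with at most n^c vertices that contains every n-vertex tree as an induced subgraph. -/
open SimpleGraph

/-- `H` is a minor of `G`: there are pairwise disjoint, connected (hence nonempty) branch
sets, one for each vertex of `H`, with an edge of `G` between the branch sets of any two
adjacent vertices of `H`. -/
def SimpleGraph.HasMinor {α : Type*} {β : Type*} (G : SimpleGraph α) (H : SimpleGraph β) : Prop :=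
  ∃ B : β → Set α,
    (∀ b, (SimpleGraph.induce (B b) G).Connected) ∧
    (Pairwise fun b b' => Disjoint (B b) (B b')) ∧
    (∀ b b', H.Adj b b' → ∃ u ∈ B b, ∃ v ∈ B b', G.Adj u v)
/-- `G` has a tree-decomposition of width at most `k`. -/
def HasTreewidthAtMost {V : Type*} (G : SimpleGraph V) (k : ℕ) : Prop :=
  ∃ (ι : Type) (_ : Fintype ι) (T : SimpleGraph ι) (B : ι → Set V),
    T.IsTree ∧
    (∀ v, ∃ t, v ∈ B t) ∧
    (∀ u v, G.Adj u v → ∃ t, u ∈ B t ∧ v ∈ B t) ∧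
    (∀ v, (SimpleGraph.induce {t | v ∈ B t} T).Connected) ∧
    (∀ t, (B t).ncard ≤ k + 1)
/-- `U` contains `H` as an induced subgraph. -/
def ContainsInd {α β : Type*} (U : SimpleGraph β) (H : SimpleGraph α) : Prop :=
  ∃ f : α → β, Function.Injective f ∧ ∀ a b, H.Adj a b ↔ U.Adj (f a) (f b)
/-- Planarity, via Wagner's theorem: no `K₅` minor and no `K₃,₃` minor. -/
def IsPlanarW {V : Type*} (G : SimpleGraph V) : Prop :=
  ¬ G.HasMinor (⊤ : SimpleGraph (Fin 5)) ∧
  ¬ G.HasMinor (completeBipartiteGraph (Fin 3) (Fin 3))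

/-- A letter `(s, k, f₁, f₂)` extending a word: `s` selects the pair of earlier words the new word
may be joined to, `k` distinguishes copies, and `f₁`, `f₂` say which of the two edges are present. -/
abbrev Letter : Type := Fin 3 × Fin 3 × Bool × Bool

/-- The pair of parents of a one-letter extension of `w` on side `s`, where `q` is the pair of
parents of `w`. -/
def sidePair (s : Fin 3) (w : List Letter) (q : Option (List Letter) × Option (List Letter)) :
    Option (List Letter) × Option (List Letter) :=
  if s = 0 then q else if s = 1 then (q.1, some w) else (some w, q.2)

/-- The (at most two) parents of a word. -/
def parents : List Letter → Option (List Letter) × Option (List Letter)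
  | [] => (none, none)
  | l :: w => sidePair l.1 w (parents w)

/-- Which of the parents a word is joined to. -/
def joined : List Letter → Bool × Bool
  | [] => (false, false)
  | l :: _ => l.2.2

def IsParent (y x : List Letter) : Prop := (parents x).1 = some y ∨ (parents x).2 = some y

def Arc (x y : List Letter) : Prop :=
  ((parents x).1 = some y ∧ (joined x).1 = true) ∨ ((parents x).2 = some y ∧ (joined x).2 = true)

lemma Arc.isParent {x y : List Letter} (h : Arc x y) : IsParent y x := h.imp And.left And.left

lemma isParent_cons {l : Letter} {y z : List Letter} (h : IsParent y (l :: z)) :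
    y = z ∨ IsParent y z := by
  unfold IsParent at *
  simp only [parents, sidePair] at h
  split_ifs at h <;> grind

lemma IsParent.suffix {x y : List Letter} (h : IsParent y x) :
    y <:+ x ∧ y.length < x.length := by
  induction x with
  | nil => simp [IsParent, parents] at h
  | cons l z ih =>
    rcases isParent_cons h with rfl | h
    · simp
    · obtain ⟨h₁, h₂⟩ := ih h
      exact ⟨h₁.trans (List.suffix_cons l z), by simp; omega⟩

lemma parents_ne {x p : List Letter} (h₁ : (parents x).1 = some p) (h₂ : (parents x).2 = some p) :
    False := by
  induction x with
  | nil => simp [parents] at h₁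
  | cons l z ih =>
    simp only [parents, sidePair] at h₁ h₂
    split_ifs at h₁ h₂
    · exact ih h₁ h₂
    · simp only [Option.some.injEq] at h₂
      subst h₂
      exact absurd (IsParent.suffix (Or.inl h₁)).2 (lt_irrefl _)
    · simp only [Option.some.injEq] at h₁
      subst h₁
      exact absurd (IsParent.suffix (Or.inr h₂)).2 (lt_irrefl _)

lemma IsParent.suffix_or {t x y : List Letter} (h : IsParent y x) (ht : t <:+ x) :
    t <:+ y ∨ IsParent y t := by
  induction x with
  | nil => simp [IsParent, parents] at h
  | cons l z ih =>
    rcases List.suffix_cons_iff.1 ht with rfl | ht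
    · exact Or.inr h
    · rcases isParent_cons h with rfl | h
      · exact Or.inl ht
      · exact ih h ht

/-- The universal graph on all words. -/
def wordGraph : SimpleGraph (List Letter) where
  Adj x y := Arc x y ∨ Arc y x
  symm := ⟨fun _ _ h => h.symm⟩
  loopless := ⟨fun _ h => absurd (h.elim Arc.isParent Arc.isParent).suffix.2 (lt_irrefl _)⟩

lemma wordGraph_adj_suffix_or {t x y : List Letter} (h : wordGraph.Adj x y) (ht : t <:+ x) :
    t <:+ y ∨ IsParent y t := by
  rcases h with h | h
  · exact h.isParent.suffix_or ht
  · exact Or.inl (ht.trans h.isParent.suffix.1)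

lemma wordGraph_adj_iff_arc {x p : List Letter} (h : p.length ≤ x.length) :
    wordGraph.Adj x p ↔ Arc x p :=
  ⟨fun h' => h'.resolve_right fun h'' => by have := h''.isParent.suffix.2; omega, Or.inl⟩

lemma arc_iff_left {x p : List Letter} (h : (parents x).1 = some p) :
    Arc x p ↔ (joined x).1 = true :=
  ⟨fun h' => h'.elim And.right fun h'' => (parents_ne h h''.1).elim, fun h' => Or.inl ⟨h, h'⟩⟩

lemma arc_iff_right {x p : List Letter} (h : (parents x).2 = some p) :
    Arc x p ↔ (joined x).2 = true :=
  ⟨fun h' => h'.elim (fun h'' => (parents_ne h''.1 h).elim) And.right, fun h' => Or.inr ⟨h, h'⟩⟩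

/-- The vertices of `F` embed as words extending any given word by at most `d` letters, the first
of which lies on any prescribed side and copy, in such a way that `α` and `β` describe the
adjacencies to the two parents. -/
def Embeds {V : Type*} (H : SimpleGraph V) (d : ℕ) (F : Set V) (α β : V → Prop) : Prop :=
  ∀ (w : List Letter) (s k : Fin 3), ∃ f : V → List Letter,
    (∀ x ∈ F, (∃ g, ((s, k, g) :: w) <:+ f x) ∧ (f x).length ≤ w.length + d) ∧
    Set.InjOn f F ∧
    (∀ x ∈ F, ∀ y ∈ F, H.Adj x y ↔ wordGraph.Adj (f x) (f y)) ∧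
    (∀ x ∈ F, ∀ p, (sidePair s w (parents w)).1 = some p → (wordGraph.Adj (f x) p ↔ α x)) ∧
    (∀ x ∈ F, ∀ p, (sidePair s w (parents w)).2 = some p → (wordGraph.Adj (f x) p ↔ β x))

section Embeds

variable {V : Type*} {H : SimpleGraph V} {d : ℕ} {F : Set V} {α β : V → Prop}

lemma Embeds.empty : Embeds H d ∅ α β := fun _ _ _ => ⟨fun _ => [], by simp⟩

lemma Embeds.mono {F' : Set V} (h : Embeds H d F α β) (hF : F' ⊆ F) : Embeds H d F' α β := by
  intro w s k
  obtain ⟨f, h₁, h₂, h₃, h₄, h₅⟩ := h w s k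
  exact ⟨f, fun x hx => h₁ x (hF hx), h₂.mono hF, fun x hx y hy => h₃ x (hF hx) y (hF hy),
    fun x hx => h₄ x (hF hx), fun x hx => h₅ x (hF hx)⟩

/-- The boundary predicates of the pieces hanging on the three sides of a vertex `v`. -/
def sidePred (α β γ : V → Prop) (s : Fin 3) : (V → Prop) × (V → Prop) :=
  if s = 0 then (α, β) else if s = 1 then (α, γ) else (γ, β)

lemma Embeds.step (v : V) (G : Fin 3 → Fin 3 → Set V)
    (hG : ∀ s k, Embeds H d (G s k) (sidePred α β (H.Adj · v) s).1 (sidePred α β (H.Adj · v) s).2)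
    (hcover : ∀ x ∈ F, x ≠ v → ∃ s k, x ∈ G s k)
    (hcross : ∀ s k s' k' x y, x ∈ G s k → y ∈ G s' k' → H.Adj x y → s = s' ∧ k = k')
    (h0 : ∀ k, ∀ x ∈ G 0 k, ¬ H.Adj x v)
    (h1 : ∀ k, ∀ x ∈ G 1 k, ¬ β x) (h2 : ∀ k, ∀ x ∈ G 2 k, ¬ α x) :
    Embeds H (d + 1) F α β := by
  classical
  intro w s k
  set w' : List Letter := (s, k, decide (α v), decide (β v)) :: w with hw'
  choose f hf hinj hadj hl hr using fun s' k' => hG s' k' w' s' k'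
  choose! S K hSK using hcover
  have hpar : parents w' = sidePair s w (parents w) := rfl
  have hlen : w'.length = w.length + 1 := rfl
  have hlt : ∀ x ∈ F, x ≠ v → w'.length < (f (S x) (K x) x).length := fun x hx hxv => by
    obtain ⟨⟨g, hg⟩, -⟩ := hf _ _ x (hSK x hx hxv)
    have := hg.length_le
    simp only [List.length_cons] at this ⊢
    omega
  have hsuf : ∀ x ∈ F, x ≠ v → w' <:+ f (S x) (K x) x := fun x hx hxv => by
    obtain ⟨⟨g, hg⟩, -⟩ := hf _ _ x (hSK x hx hxv)
    exact (List.suffix_cons _ _).trans hg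
  have hsame : ∀ x ∈ F, x ≠ v → ∀ y ∈ F, y ≠ v → ∀ g : Bool × Bool,
      ((S x, K x, g) :: w') <:+ f (S y) (K y) y → S x = S y ∧ K x = K y := by
    intro x hx hxv y hy hyv g h
    obtain ⟨⟨g', hg'⟩, -⟩ := hf _ _ y (hSK y hy hyv)
    have := (List.suffix_of_suffix_length_le h hg' (by simp)).eq_of_length (by simp)
    simp only [List.cons.injEq, Prod.mk.injEq] at this
    exact ⟨this.1.1, this.1.2.1⟩
  have hv : ∀ x ∈ F, x ≠ v → (H.Adj x v ↔ wordGraph.Adj (f (S x) (K x) x) w') := by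
    intro x hx hxv
    have hm := hSK x hx hxv
    obtain ⟨⟨g, hg⟩, -⟩ := hf _ _ x hm
    have hl' := hl _ _ x hm
    have hr' := hr _ _ x hm
    generalize S x = a at *
    generalize K x = b at *
    fin_cases a
    · refine ⟨fun h => (h0 _ x hm h).elim, fun h => ?_⟩
      rcases wordGraph_adj_suffix_or h hg with h | h
      · have := h.length_le
        simp at this
      · exact absurd (IsParent.suffix (x := w') h).2 (lt_irrefl _)
    · simpa [sidePred] using (hr' w' (by simp [sidePair])).symm
    · simpa [sidePred] using (hl' w' (by simp [sidePair])).symm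
  have hbase : ∀ p, IsParent p w' → (wordGraph.Adj w' p ↔ Arc w' p) := fun p hp =>
    wordGraph_adj_iff_arc hp.suffix.2.le
  have hnot : ∀ x ∈ F, x ≠ v → ∀ p, IsParent p w' →
      wordGraph.Adj (f (S x) (K x) x) p → (sidePair (S x) w' (parents w')).1 = some p ∨
        (sidePair (S x) w' (parents w')).2 = some p := by
    intro x hx hxv p hp h
    obtain ⟨⟨g, hg⟩, -⟩ := hf _ _ x (hSK x hx hxv)
    rcases wordGraph_adj_suffix_or h hg with h | h
    · have h₁ := h.length_le
      have h₂ := hp.suffix.2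
      simp only [List.length_cons] at h₁ h₂
      omega
    · exact h
  refine ⟨fun x => if x = v then w' else f (S x) (K x) x, ?_, ?_, ?_, ?_, ?_⟩
  · intro x hx
    by_cases hxv : x = v
    · simp only [hxv, if_true]
      exact ⟨⟨_, List.suffix_rfl⟩, by omega⟩
    · simp only [hxv, if_false]
      refine ⟨⟨_, hsuf x hx hxv⟩, ?_⟩
      have := (hf _ _ x (hSK x hx hxv)).2
      omega
  · intro x hx y hy hxy
    by_cases hxv : x = v <;> by_cases hyv : y = v <;> simp only [hxv, hyv, if_true, if_false] at hxy
    · rw [hxv, hyv]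
    · have := hlt y hy hyv
      rw [← hxy] at this
      omega
    · have := hlt x hx hxv
      rw [hxy] at this
      omega
    · obtain ⟨⟨g, hg⟩, -⟩ := hf _ _ x (hSK x hx hxv)
      rw [hxy] at hg
      obtain ⟨hS, hK⟩ := hsame x hx hxv y hy hyv g hg
      rw [hS, hK] at hxy
      refine hinj _ _ ?_ (hSK y hy hyv) hxy
      rw [← hS, ← hK]
      exact hSK x hx hxv
  · intro x hx y hy
    by_cases hxv : x = v <;> by_cases hyv : y = v <;> simp only [hxv, hyv, if_true, if_false]
    · simp
    · rw [H.adj_comm, wordGraph.adj_comm]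
      exact hv y hy hyv
    · exact hv x hx hxv
    · have hx' := hSK x hx hxv
      have hy' := hSK y hy hyv
      by_cases hS : S x = S y ∧ K x = K y
      · rw [hS.1, hS.2] at hx' ⊢
        exact hadj _ _ x hx' y hy'
      · refine ⟨fun h => (hS (hcross _ _ _ _ x y hx' hy' h)).elim, fun h => ?_⟩
        obtain ⟨⟨g, hg⟩, -⟩ := hf _ _ x hx'
        rcases wordGraph_adj_suffix_or h hg with h | h
        · exact (hS (hsame x hx hxv y hy hyv g h)).elim
        · rcases isParent_cons h with h | h
          · have := hlt y hy hyv
            rw [h] at this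
            omega
          · have := hlt y hy hyv
            have := h.suffix.2
            omega
  · intro x hx p hp
    by_cases hxv : x = v
    · simp only [hxv, if_true]
      rw [hbase p (Or.inl hp), arc_iff_left (x := w') hp]
      simp [hw', joined]
    · simp only [hxv, if_false]
      have hm := hSK x hx hxv
      have hn := hnot x hx hxv p (Or.inl hp)
      have hl' := hl _ _ x hm p
      generalize S x = a at *
      generalize K x = b at *
      fin_cases a
      · exact hl' hp
      · exact hl' hp
      · refine ⟨fun h => ?_, fun h => (h2 _ x hm h).elim⟩
        rcases hn h with h | h
        · simp only [sidePair] at h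
          simp at h
          exact absurd (IsParent.suffix (x := w') (Or.inl hp)).2 (h ▸ lt_irrefl _)
        · exact (parents_ne (x := w') hp h).elim
  · intro x hx p hp
    by_cases hxv : x = v
    · simp only [hxv, if_true]
      rw [hbase p (Or.inr hp), arc_iff_right (x := w') hp]
      simp [hw', joined]
    · simp only [hxv, if_false]
      have hm := hSK x hx hxv
      have hn := hnot x hx hxv p (Or.inr hp)
      have hr' := hr _ _ x hm p
      generalize S x = a at *
      generalize K x = b at *
      fin_cases a
      · exact hr' hp
      · refine ⟨fun h => ?_, fun h => (h1 _ x hm h).elim⟩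
        rcases hn h with h | h
        · exact (parents_ne (x := w') h hp).elim
        · simp only [sidePair] at h
          simp at h
          exact absurd (IsParent.suffix (x := w') (Or.inr hp)).2 (h ▸ lt_irrefl _)
      · exact hr' hp

end Embeds

/-- In a connected induced subgraph, some edge leaves every proper part. -/
lemma exists_adj_of_induce_connected {V : Type*} {G : SimpleGraph V} {B : Set V}
    (hB : (G.induce B).Connected) (S : Set V) {x y : V} (hx : x ∈ B) (hy : y ∈ B)
    (hxS : x ∈ S) (hyS : y ∉ S) : ∃ u ∈ B, ∃ v ∈ B, G.Adj u v ∧ u ∈ S ∧ v ∉ S := by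
  obtain ⟨p⟩ := hB.preconnected ⟨x, hx⟩ ⟨y, hy⟩
  obtain ⟨e, -, h₁, h₂⟩ := p.exists_boundary_dart (Subtype.val ⁻¹' S) hxS hyS
  exact ⟨_, e.fst.2, _, e.snd.2, e.adj, h₁, h₂⟩

/-- Induced subgraphs of the word graph have no minor of minimum degree at least three. -/
lemma not_hasMinor_of_three_neighbors {V : Type*} {G : SimpleGraph V} (e : V → List Letter)
    (he : Function.Injective e) (hG : ∀ x y, G.Adj x y → wordGraph.Adj (e x) (e y))
    {β : Type*} [Finite β] [Nonempty β] (K : SimpleGraph β)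
    (hK : ∀ b, ∃ f : Fin 3 → β, Function.Injective f ∧ ∀ i, K.Adj b (f i)) : ¬ G.HasMinor K := by
  rintro ⟨B, hconn, hdisj, hadj⟩
  have hmin : ∀ b, ∃ t ∈ B b, ∀ x ∈ B b, (e t).length ≤ (e x).length := fun b => by
    obtain ⟨⟨x, hx⟩⟩ := (hconn b).nonempty
    obtain ⟨t, ht, h⟩ := (measure fun x => (e x).length).wf.has_min (B b) ⟨x, hx⟩
    exact ⟨t, ht, fun x hx => not_lt.1 (h x hx)⟩
  choose t ht htmin using hmin
  obtain ⟨i, hi⟩ := Finite.exists_max fun b => (e (t b)).length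
  have hbelow : ∀ x ∈ B i, e (t i) <:+ e x := by
    by_contra! hcon
    obtain ⟨y, hy, hyt⟩ := hcon
    obtain ⟨u, hu, v, hv, huv, h₁, h₂⟩ := exists_adj_of_induce_connected (hconn i)
      {x | e (t i) <:+ e x} (ht i) hy List.suffix_rfl hyt
    have := (wordGraph_adj_suffix_or (hG _ _ huv) h₁).resolve_left h₂
    exact absurd this.suffix.2 (not_lt.2 (htmin i v hv))
  have hpar : ∀ j, K.Adj i j → ∃ v ∈ B j, IsParent (e v) (e (t i)) := by
    intro j hij
    obtain ⟨u, hu, v, hv, huv⟩ := hadj i j hij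
    rcases wordGraph_adj_suffix_or (hG _ _ huv) (hbelow u hu) with h | h
    · have hnot : ¬ e (t i) <:+ e (t j) := fun h' =>
        Set.disjoint_left.1 (hdisj hij.ne) (ht i) (he (h'.eq_of_length_le (hi j)) ▸ ht j)
      obtain ⟨x, hx, y, hy, hxy, h₁, h₂⟩ := exists_adj_of_induce_connected (hconn j)
        {x | e (t i) <:+ e x} hv (ht j) h hnot
      exact ⟨y, hy, (wordGraph_adj_suffix_or (hG _ _ hxy) h₁).resolve_left h₂⟩
    · exact ⟨v, hv, h⟩
  obtain ⟨f, hf, hfK⟩ := hK i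
  choose v hv hvp using fun k => hpar (f k) (hfK k)
  have hinj : ∀ k l, v k = v l → k = l := fun k l hkl => by
    by_contra hne
    exact Set.disjoint_left.1 (hdisj (hf.ne hne)) (hv k) (hkl ▸ hv l)
  have key : ∀ k l m : Fin 3, k ≠ l → k ≠ m → l ≠ m → False := by
    intro k l m hkl hkm hlm
    have h₁ := fun h => hkl (hinj k l (he h))
    have h₂ := fun h => hkm (hinj k m (he h))
    have h₃ := fun h => hlm (hinj l m (he h))
    have h₄ := hvp k
    have h₅ := hvp l
    have h₆ := hvp m
    unfold IsParent at h₄ h₅ h₆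
    grind
  exact key 0 1 2 (by decide) (by decide) (by decide)

/-- The words with at most `d` letters. -/
abbrev Words (d : ℕ) : Type := {w : List Letter // w.length ≤ d}

instance (d : ℕ) : Finite (Words d) := (List.finite_length_le Letter d).to_subtype

lemma card_words_le (d : ℕ) : Nat.card (Words d) ≤ 64 ^ d := by
  induction d with
  | zero =>
    have : Subsingleton (Words 0) := ⟨fun x y => Subtype.ext <| by
      rw [List.length_eq_zero_iff.1 (Nat.le_zero.1 x.2),
        List.length_eq_zero_iff.1 (Nat.le_zero.1 y.2)]⟩
    simp
  | succ d ih =>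
    let f : Words (d + 1) → Option (Letter × Words d) := fun w =>
      match w with
      | ⟨[], _⟩ => none
      | ⟨l :: z, h⟩ => some (l, ⟨z, by simpa using h⟩)
    have hf : Function.Injective f := by
      rintro ⟨_ | ⟨l, z⟩, h⟩ ⟨_ | ⟨l', z'⟩, h'⟩ hff <;> simp_all [f]
    have h₁ := Nat.card_le_card_of_injective f hf
    have h₂ : Nat.card Letter = 36 := by simp [Nat.card_eq_fintype_card]
    rw [Finite.card_option, Nat.card_prod, h₂] at h₁
    have h₃ : 1 ≤ 64 ^ d := Nat.one_le_pow _ _ (by norm_num)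
    rw [pow_succ]
    omega

/-- The prefix tree on the words with at most `d` letters. -/
def wordTree (d : ℕ) : SimpleGraph (Words d) where
  Adj x y := (∃ l, x.1 = l :: y.1) ∨ ∃ l, y.1 = l :: x.1
  symm := ⟨fun _ _ h => h.symm⟩
  loopless := ⟨fun x h => by simp at h⟩

lemma wordTree_connected (d : ℕ) : (wordTree d).Connected := by
  have hroot : ∀ (w : List Letter) (h : w.length ≤ d),
      (wordTree d).Reachable ⟨w, h⟩ ⟨[], Nat.zero_le d⟩ := by
    intro w
    induction w with
    | nil => exact fun _ => Reachable.refl _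
    | cons l z ih =>
      intro h
      have hz : z.length ≤ d := by simp at h; omega
      exact Reachable.trans (Adj.reachable (Or.inl ⟨l, rfl⟩ : (wordTree d).Adj _ ⟨z, hz⟩)) (ih hz)
  exact (connected_iff _).2 ⟨fun x y => (hroot x.1 x.2).trans (hroot y.1 y.2).symm, ⟨⟨[], Nat.zero_le d⟩⟩⟩

lemma wordTree_isTree (d : ℕ) : (wordTree d).IsTree := by
  rw [isTree_iff_connected_and_card]
  refine ⟨wordTree_connected d,
    le_antisymm ?_ (wordTree_connected d).card_vert_le_card_edgeSet_add_one⟩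
  let root : Words d := ⟨[], Nat.zero_le d⟩
  let f : Words d → Sym2 (Words d) := fun w =>
    s(w, ⟨w.1.tail, by have := w.2; simp; omega⟩)
  have hsub : (wordTree d).edgeSet ⊆ f '' {root}ᶜ := by
    rintro ⟨x, y⟩ (⟨l, h⟩ | ⟨l, h⟩)
    · refine ⟨x, ?_, ?_⟩
      · rintro rfl
        simp [root] at h
      · exact Sym2.eq_iff.2 (Or.inl ⟨rfl, Subtype.ext (congrArg List.tail h)⟩)
    · refine ⟨y, ?_, ?_⟩
      · rintro rfl
        simp [root] at h
      · exact Sym2.eq_iff.2 (Or.inr ⟨rfl, Subtype.ext (congrArg List.tail h)⟩)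
  have h₁ := Set.ncard_le_ncard hsub (Set.toFinite _)
  have h₂ := Set.ncard_image_le (f := f) (Set.toFinite ({root}ᶜ : Set (Words d)))
  have h₃ := Set.ncard_add_ncard_compl ({root} : Set (Words d))
  rw [Set.ncard_singleton] at h₃
  rw [Nat.card_coe_set_eq]
  omega

lemma hasTreewidthAtMost_two {V : Type*} {G : SimpleGraph V} {d : ℕ} (e : V ≃ Words d)
    (hG : ∀ x y, G.Adj x y → wordGraph.Adj (e x).1 (e y).1) : HasTreewidthAtMost G 2 := by
  have := Fintype.ofFinite (Words d)
  let B : Words d → Set V := fun t => {v | (e v).1 = t.1 ∨ IsParent (e v).1 t.1}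
  refine ⟨Words d, inferInstance, wordTree d, B, wordTree_isTree d,
    fun v => ⟨e v, Or.inl rfl⟩, ?_, ?_, ?_⟩
  · intro u v huv
    rcases hG u v huv with h | h
    · exact ⟨e u, Or.inl rfl, Or.inr h.isParent⟩
    · exact ⟨e v, Or.inr h.isParent, Or.inl rfl⟩
  · intro v
    let b : {t | v ∈ B t} := ⟨e v, Or.inl rfl⟩
    have hb : ∀ (w : List Letter) (h : w.length ≤ d) (h' : v ∈ B ⟨w, h⟩),
        ((wordTree d).induce {t | v ∈ B t}).Reachable ⟨⟨w, h⟩, h'⟩ b := by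
      intro w
      induction w with
      | nil =>
        rintro h (h' | h')
        · have : (⟨⟨[], h⟩, Or.inl h'⟩ : {t | v ∈ B t}) = b := Subtype.ext (Subtype.ext h'.symm)
          rw [this]
        · simp [IsParent, parents] at h'
      | cons l z ih =>
        intro h h'
        by_cases hv : (e v).1 = l :: z
        · have : (⟨⟨l :: z, h⟩, h'⟩ : {t | v ∈ B t}) = b := Subtype.ext (Subtype.ext hv.symm)
          rw [this]
        · have hz : z.length ≤ d := by simp at h; omega
          have hm : v ∈ B ⟨z, hz⟩ := isParent_cons (h'.resolve_left hv)
          refine Reachable.trans (Adj.reachable ?_) (ih hz hm)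
          exact Or.inl ⟨l, rfl⟩
    exact (connected_iff _).2 ⟨fun x y => (hb x.1.1 x.1.2 x.2).trans (hb y.1.1 y.1.2 y.2).symm, ⟨b⟩⟩
  · intro t
    have hinj : Function.Injective fun v => some (e v).1 := fun x y h =>
      e.injective (Subtype.ext (Option.some_injective _ h))
    have hsub : (fun v => some (e v).1) '' B t ⊆
        {some t.1, (parents t.1).1, (parents t.1).2} := by
      rintro _ ⟨v, hv | hv | hv, rfl⟩
      · simp [hv]
      · simp [hv]
      · simp [hv]
    calc (B t).ncard = ((fun v => some (e v).1) '' B t).ncard :=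
          (Set.ncard_image_of_injective _ hinj).symm
      _ ≤ _ := Set.ncard_le_ncard hsub (Set.toFinite _)
      _ ≤ 2 + 1 := by
        refine (Set.ncard_insert_le _ _).trans ?_
        have := Set.ncard_insert_le (parents t.1).1 {(parents t.1).2}
        rw [Set.ncard_singleton] at this
        omega

/-- A set function that is superadditive on subsets of `S` with `m S ≤ 2 t + 1` splits `S` into two
parts of value at most `t` (colours `0` and `2`) and one further element (colour `1`). -/
lemma exists_balanced_colouring {V : Type*} [Finite V] (S : Set V) (m : Set V → ℕ) (t : ℕ)
    (h0 : m ∅ = 0) (hadd : ∀ A ⊆ S, ∀ B ⊆ S, Disjoint A B → m A + m B ≤ m S)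
    (hS : m S ≤ 2 * t + 1) :
    ∃ κ : V → Fin 3, (∀ k ≠ 1, m {c | c ∈ S ∧ κ c = k} ≤ t) ∧
      (∀ c ∈ S, ∀ c' ∈ S, κ c = 1 → κ c' = 1 → c = c') ∧ (S.Nonempty → ∃ c ∈ S, κ c = 1) := by
  classical
  rcases S.eq_empty_or_nonempty with rfl | hne
  · exact ⟨fun _ => 0, by simp [h0], by simp, by simp⟩
  obtain ⟨A, ⟨hAS, hAt⟩, hmax⟩ := Set.exists_max_image {A : Set V | A ⊂ S ∧ m A ≤ t} Set.ncard
    (Set.toFinite _) ⟨∅, Set.empty_ssubset.2 hne, by omega⟩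
  obtain ⟨c, hcS, hcA⟩ := Set.exists_of_ssubset hAS
  have hins : insert c A ⊆ S := Set.insert_subset hcS hAS.subset
  have hrest : m (S \ insert c A) ≤ t := by
    by_cases h : insert c A = S
    · simp [h, h0]
    · have h₁ : ¬ m (insert c A) ≤ t := fun h' => by
        have := hmax _ ⟨hins.ssubset_of_ne h, h'⟩
        rw [Set.ncard_insert_of_notMem hcA] at this
        omega
      have := hadd _ hins _ Set.sdiff_subset (disjoint_sdiff_self_right)
      omega
  refine ⟨fun x => if x = c then 1 else if x ∈ A then 0 else 2, ?_, ?_, ?_⟩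
  · intro k hk
    have hk' : k = 0 ∨ k = 2 := by omega
    rcases hk' with rfl | rfl
    · convert hAt using 2
      ext x
      have hx : x ∈ A → x ∈ S := fun hx => hAS.subset hx
      simp only [Set.mem_ofPred_eq]
      split_ifs <;> simp_all
    · convert hrest using 2
      ext x
      simp only [Set.mem_ofPred_eq, Set.mem_sdiff, Set.mem_insert_iff]
      split_ifs <;> simp_all
  · intro x _ y _ hx hy
    dsimp only at hx hy
    split_ifs at hx hy <;> simp_all
  · exact fun _ => ⟨c, hcS, by simp⟩

/-- `R` is the child-to-parent relation of a rooting of `H` with depth function `δ`. -/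
structure IsRooting {V : Type*} (H : SimpleGraph V) (R : V → V → Prop) (δ : V → ℕ) : Prop where
  rightUnique : Relator.RightUnique R
  depth : ∀ {x y}, R x y → δ x = δ y + 1
  adj_iff : ∀ {x y}, H.Adj x y ↔ R x y ∨ R y x

/-- The descendants of `u`, including `u`. -/
def descendants {V : Type*} (R : V → V → Prop) (u : V) : Set V := {x | Relation.ReflTransGen R x u}

/-- The descendants of the elements of `S` that are not descendants of `b`. -/
def piece {V : Type*} (R : V → V → Prop) (S : Set V) (b : Option V) : Set V :=
  {x | (∃ c ∈ S, x ∈ descendants R c) ∧ ∀ v ∈ b, x ∉ descendants R v}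

lemma mem_descendants_self {V : Type*} {R : V → V → Prop} (u : V) : u ∈ descendants R u :=
  Relation.ReflTransGen.refl

lemma mem_descendants_trans {V : Type*} {R : V → V → Prop} {x y z : V}
    (h : x ∈ descendants R y) (h' : y ∈ descendants R z) : x ∈ descendants R z :=
  Relation.ReflTransGen.trans h h'

lemma mem_descendants_of_rel {V : Type*} {R : V → V → Prop} {x y u : V}
    (hxy : R x y) (h : y ∈ descendants R u) : x ∈ descendants R u :=
  Relation.ReflTransGen.head hxy h

lemma eq_or_mem_descendants_child {V : Type*} {R : V → V → Prop} {x u : V}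
    (h : x ∈ descendants R u) : x = u ∨ ∃ c, R c u ∧ x ∈ descendants R c := by
  rcases Relation.ReflTransGen.cases_tail h with h | ⟨c, h₁, h₂⟩
  · exact Or.inl h.symm
  · exact Or.inr ⟨c, h₂, h₁⟩

lemma piece_empty {V : Type*} {R : V → V → Prop} (b : Option V) : piece R ∅ b = ∅ := by
  simp [piece]

namespace IsRooting

variable {V : Type*} {H : SimpleGraph V} {R : V → V → Prop} {δ : V → ℕ}

lemma parent_mem (h : IsRooting H R δ) {x y u : V} (hx : x ∈ descendants R u) (hxy : R x y) :
    x = u ∨ y ∈ descendants R u := by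
  rcases Relation.ReflTransGen.cases_head hx with rfl | ⟨z, hz, hzu⟩
  · exact Or.inl rfl
  · exact Or.inr (h.rightUnique hxy hz ▸ hzu)

lemma depth_le (h : IsRooting H R δ) {x u : V} (hx : x ∈ descendants R u) : δ u ≤ δ x := by
  induction hx with
  | refl => exact le_rfl
  | tail _ hR ih => have := h.depth hR; omega

lemma eq_of_depth_le (h : IsRooting H R δ) {x u : V} (hx : x ∈ descendants R u)
    (hd : δ x ≤ δ u) : x = u := by
  rcases Relation.ReflTransGen.cases_head hx with rfl | ⟨z, hz, hzu⟩
  · rfl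
  · have := h.depth hz
    have := h.depth_le hzu
    omega

lemma comparable (h : IsRooting H R δ) {x u v : V} (hu : x ∈ descendants R u)
    (hv : x ∈ descendants R v) : u ∈ descendants R v ∨ v ∈ descendants R u :=
  Relation.ReflTransGen.total_of_right_unique h.rightUnique hu hv

lemma eq_of_mem_descendants (h : IsRooting H R δ) {x u v : V} (hu : x ∈ descendants R u)
    (hv : x ∈ descendants R v) (hd : δ u = δ v) : u = v :=
  (h.comparable hu hv).elim (fun h' => h.eq_of_depth_le h' hd.le)
    fun h' => (h.eq_of_depth_le h' hd.ge).symm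

lemma ncard_piece_add_le [Finite V] (h : IsRooting H R δ) {a : V} {S : Set V}
    (hS : ∀ c ∈ S, R c a) (b : Option V) :
    ∀ A ⊆ S, ∀ B ⊆ S, Disjoint A B →
      (piece R A b).ncard + (piece R B b).ncard ≤ (piece R S b).ncard := by
  intro A hA B hB hAB
  rw [← Set.ncard_union_eq _ (Set.toFinite _) (Set.toFinite _)]
  · refine Set.ncard_le_ncard ?_ (Set.toFinite _)
    rintro x (⟨⟨c, hc, hx⟩, hb⟩ | ⟨⟨c, hc, hx⟩, hb⟩)
    · exact ⟨⟨c, hA hc, hx⟩, hb⟩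
    · exact ⟨⟨c, hB hc, hx⟩, hb⟩
  · rw [Set.disjoint_left]
    rintro x ⟨⟨c, hc, hx⟩, -⟩ ⟨⟨c', hc', hx'⟩, -⟩
    have h₁ := h.depth (hS c (hA hc))
    have h₂ := h.depth (hS c' (hB hc'))
    exact Set.disjoint_left.1 hAB hc (h.eq_of_mem_descendants hx hx' (by omega) ▸ hc')

theorem embeds_piece [Finite V] (h : IsRooting H R δ) (d : ℕ) :
    ∀ (j : ℕ) (a : V) (S : Set V) (b : Option V), (∀ c ∈ S, R c a) →
      (∀ v ∈ b, a ∉ descendants R v) → (piece R S b).ncard < 2 ^ j →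
      ((∀ v ∈ b, ∀ c ∈ S, v ∉ descendants R c) ∧ 2 * j ≤ d ∨ 2 * j + 1 ≤ d) →
      Embeds H d (piece R S b) (H.Adj · a) (fun x => ∃ v ∈ b, H.Adj x v) := by
  classical
  induction d with
  | zero =>
    intro j a S b _ _ hcard hj
    obtain rfl : j = 0 := by omega
    rw [pow_zero, Nat.lt_one_iff, Set.ncard_eq_zero (Set.toFinite _)] at hcard
    rw [hcard]
    exact Embeds.empty
  | succ d ih =>
    intro j a S b hS hab hcard hj
    rcases (piece R S b).eq_empty_or_nonempty with hF | hF
    · rw [hF]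
      exact Embeds.empty
    have hj0 : j ≠ 0 := by
      rintro rfl
      rw [pow_zero, Nat.lt_one_iff, Set.ncard_eq_zero (Set.toFinite _)] at hcard
      exact hF.ne_empty hcard
    obtain ⟨i, rfl⟩ := Nat.exists_eq_succ_of_ne_zero hj0
    obtain ⟨t, ht⟩ : ∃ t, 2 ^ i = t + 1 := ⟨2 ^ i - 1, by have := Nat.one_le_two_pow (n := i); omega⟩
    have hFt : (piece R S b).ncard ≤ 2 * t + 1 := by
      rw [Nat.succ_eq_add_one, pow_succ] at hcard
      omega
    have hi : 2 * i + 1 ≤ d := by omega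
    set S' : Set V := {c | c ∈ S ∧ c ∉ b} with hS'
    have hnb : ∀ c ∈ S', ∀ v ∈ b, c ∉ descendants R v := by
      intro c hc v hv hcv
      rcases h.parent_mem hcv (hS c hc.1) with rfl | h'
      · exact hc.2 hv
      · exact hab v hv h'
    have hcover₀ : ∀ x ∈ piece R S b, ∃ c ∈ S', x ∈ descendants R c := by
      rintro x ⟨⟨c, hc, hx⟩, hxb⟩
      exact ⟨c, ⟨hc, fun hcb => hxb c hcb hx⟩, hx⟩
    have hsub₀ : piece R S' b ⊆ piece R S b := by
      rintro x ⟨⟨c, hc, hx⟩, hxb⟩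
      exact ⟨⟨c, hc.1, hx⟩, hxb⟩
    obtain ⟨κ, hκ, hκ1, hκc⟩ := exists_balanced_colouring S' (fun T => (piece R T b).ncard) t
      (by simp [piece_empty]) (h.ncard_piece_add_le (fun c hc => hS c hc.1) b)
      ((Set.ncard_le_ncard hsub₀ (Set.toFinite _)).trans hFt)
    obtain ⟨c, hcS', hκc⟩ := hκc (by
      obtain ⟨x, hx⟩ := hF
      obtain ⟨c, hc, -⟩ := hcover₀ x hx
      exact ⟨c, hc⟩)
    have hca := hS c hcS'.1
    obtain ⟨u, ⟨huc, hub, hut, hbu⟩, humax⟩ := Set.exists_max_image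
      {u | u ∈ descendants R c ∧ (∀ v ∈ b, u ∉ descendants R v) ∧
        (piece R {c} (some u)).ncard ≤ t ∧ ∀ v ∈ b, v ∈ descendants R c → v ∈ descendants R u} δ
      (Set.toFinite _) ⟨c, mem_descendants_self c, hnb c hcS', by
        have : piece R {c} (some c) = ∅ := by ext x; simp [piece]
        simp [this], fun _ _ => id⟩
    have hsub : piece R {c' | R c' u} b ⊆ piece R S b := by
      rintro x ⟨⟨c', hc', hx⟩, hxb⟩
      exact ⟨⟨c, hcS'.1, mem_descendants_trans (mem_descendants_trans hx
        (mem_descendants_of_rel hc' (mem_descendants_self u))) huc⟩, hxb⟩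
    obtain ⟨κ', hκ', hκ1', -⟩ := exists_balanced_colouring {c' | R c' u}
      (fun T => (piece R T b).ncard) t (by simp [piece_empty])
      (h.ncard_piece_add_le (fun c hc => hc) b)
      ((Set.ncard_le_ncard hsub (Set.toFinite _)).trans hFt)
    let G : Fin 3 → Fin 3 → Set V := fun s k =>
      if s = 0 then (if k = 1 then ∅ else piece R {x | x ∈ S' ∧ κ x = k} b)
      else if s = 1 then (if k = 0 then piece R {c} (some u) else ∅)
      else piece R {x | x ∈ {c' | R c' u} ∧ κ' x = k} b
    have hG : ∀ {s k x}, x ∈ G s k →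
        (s = 0 ∧ ∃ c₁ ∈ S', κ c₁ = k ∧ c₁ ≠ c ∧ x ∈ descendants R c₁) ∨
        (s = 1 ∧ k = 0 ∧ x ∈ descendants R c ∧ x ∉ descendants R u) ∨
        (s = 2 ∧ ∃ c', R c' u ∧ κ' c' = k ∧ x ∈ descendants R c') := by
      intro s k x hx
      simp only [G] at hx
      split_ifs at hx with h₁ h₂ h₃ h₄
      · exact hx.elim
      · obtain ⟨⟨c₁, hc₁, hx⟩, -⟩ := hx
        refine Or.inl ⟨h₁, c₁, hc₁.1, hc₁.2, ?_, hx⟩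
        rintro rfl
        exact h₂ (hc₁.2.symm.trans hκc)
      · obtain ⟨⟨_, rfl, hx⟩, hxu⟩ := hx
        exact Or.inr (Or.inl ⟨h₃, h₄, hx, hxu u rfl⟩)
      · exact hx.elim
      · obtain ⟨⟨c', hc', hx⟩, -⟩ := hx
        exact Or.inr (Or.inr ⟨by omega, c', hc'.1, hc'.2, hx⟩)
    have hsib : ∀ {x c₁ c₂}, c₁ ∈ S' → c₂ ∈ S' → x ∈ descendants R c₁ → x ∈ descendants R c₂ →
        c₁ = c₂ := fun h₁ h₂ hx₁ hx₂ => h.eq_of_mem_descendants hx₁ hx₂ <|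
      (h.depth (hS _ h₁.1)).trans (h.depth (hS _ h₂.1)).symm
    have hchild : ∀ {x c'}, R c' u → x ∈ descendants R c' → x ∈ descendants R u := fun h₁ h₂ =>
      mem_descendants_trans h₂ (mem_descendants_of_rel h₁ (mem_descendants_self u))
    have hGS : ∀ {s k x}, x ∈ G s k → ∃ c₁ ∈ S', x ∈ descendants R c₁ := by
      intro s k x hx
      rcases hG hx with ⟨-, c₁, hc₁, -, -, hx⟩ | ⟨-, -, hx, -⟩ | ⟨-, c', hc', -, hx⟩
      · exact ⟨c₁, hc₁, hx⟩
      · exact ⟨c, hcS', hx⟩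
      · exact ⟨c, hcS', mem_descendants_trans (hchild hc' hx) huc⟩
    have haG : ∀ {s k}, a ∉ G s k := fun hx => by
      obtain ⟨c₁, hc₁, hx⟩ := hGS hx
      have h₁ := h.depth (hS c₁ hc₁.1)
      have h₂ := h.depth_le hx
      omega
    have huG : ∀ {s k}, u ∉ G s k := fun hx => by
      rcases hG hx with ⟨-, c₁, hc₁, -, hne, hx⟩ | ⟨-, -, -, hx⟩ | ⟨-, c', hc', -, hx⟩
      · exact hne (hsib hc₁ hcS' hx huc)
      · exact hx (mem_descendants_self u)
      · have h₁ := h.depth hc'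
        have h₂ := h.depth_le hx
        omega
    have hcrossR : ∀ {s k s' k' x y}, x ∈ G s k → y ∈ G s' k' → R x y → s = s' ∧ k = k' := by
      intro s k s' k' x y hx hy hxy
      have hya : y ≠ a := fun h' => haG (h' ▸ hy)
      have hyu : y ≠ u := fun h' => huG (h' ▸ hy)
      have hup : ∀ {c₁}, c₁ ∈ S' → x ∈ descendants R c₁ → y ∈ descendants R c₁ := by
        intro c₁ hc₁ hx₁
        refine (h.parent_mem hx₁ hxy).resolve_left ?_
        rintro rfl
        exact hya (h.rightUnique hxy (hS _ hc₁.1))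
      rcases hG hx with ⟨rfl, c₁, hc₁, rfl, hne, hx'⟩ | ⟨rfl, rfl, hx', hxu⟩ |
        ⟨rfl, c', hc', rfl, hx'⟩
      · have hy₁ := hup hc₁ hx'
        rcases hG hy with ⟨rfl, c₂, hc₂, rfl, -, hy'⟩ | ⟨rfl, rfl, hy', -⟩ |
          ⟨rfl, c'', hc'', rfl, hy'⟩
        · rw [hsib hc₁ hc₂ hy₁ hy']
          exact ⟨rfl, rfl⟩
        · exact (hne (hsib hc₁ hcS' hy₁ hy')).elim
        · exact (hne (hsib hc₁ hcS' hy₁ (mem_descendants_trans (hchild hc'' hy') huc))).elim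
      · have hy₁ := hup hcS' hx'
        rcases hG hy with ⟨rfl, c₂, hc₂, rfl, hne, hy'⟩ | ⟨rfl, rfl, hy', -⟩ |
          ⟨rfl, c'', hc'', rfl, hy'⟩
        · exact (hne (hsib hc₂ hcS' hy' hy₁)).elim
        · exact ⟨rfl, rfl⟩
        · exact (hxu (mem_descendants_of_rel hxy (hchild hc'' hy'))).elim
      · have hy₁ : y ∈ descendants R c' := by
          refine (h.parent_mem hx' hxy).resolve_left ?_
          rintro rfl
          exact hyu (h.rightUnique hxy hc')
        have hyu' := hchild hc' hy₁
        rcases hG hy with ⟨rfl, c₂, hc₂, rfl, hne, hy'⟩ | ⟨rfl, rfl, -, hy'⟩ |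
          ⟨rfl, c'', hc'', rfl, hy'⟩
        · exact (hne (hsib hc₂ hcS' hy' (mem_descendants_trans hyu' huc))).elim
        · exact (hy' hyu').elim
        · rw [h.eq_of_mem_descendants hy₁ hy' ((h.depth hc').trans (h.depth hc'').symm)]
          exact ⟨rfl, rfl⟩
    refine Embeds.step u G ?_ ?_ ?_ ?_ ?_ ?_
    · intro s k
      by_cases hs0 : s = 0
      · subst hs0
        by_cases hk : k = 1
        · simp only [G, hk, if_true]
          exact Embeds.empty
        · simp only [G, hk, if_true, if_false, sidePred]
          refine ih i a _ b (fun c hc => hS c hc.1.1) hab ?_ (Or.inr hi)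
          have := hκ k hk
          omega
      · by_cases hs1 : s = 1
        · subst hs1
          by_cases hk : k = 0
          · have := ih i a {c} (some u) (by simpa using hca) ?_ (by omega) (Or.inr hi)
            · simpa [G, hk, sidePred] using this
            · rintro _ ⟨⟩ hau
              have h₁ := h.depth_le hau
              have h₂ := h.depth_le huc
              have h₃ := h.depth hca
              omega
          · simp only [G, hk, if_false, hs0, if_true]
            exact Embeds.empty
        · simp only [G, hs0, hs1, if_false, sidePred]
          by_cases hk : k = 1
          · subst hk
            rcases Set.eq_empty_or_nonempty {x | x ∈ {c' | R c' u} ∧ κ' x = 1} with hK | ⟨c', hc'⟩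
            · rw [hK, piece_empty]
              exact Embeds.empty
            · have hK : {x | x ∈ {c' | R c' u} ∧ κ' x = 1} = {c'} := by
                ext x
                refine ⟨fun hx => hκ1' x hx.1 c' hc'.1 hx.2 hc'.2, ?_⟩
                rintro rfl
                exact hc'
              rw [hK]
              have hc'u : R c' u := hc'.1
              have hsub' : piece R {c'} b ⊆ piece R S b := by
                refine subset_trans ?_ hsub
                rintro x ⟨⟨_, rfl, hx⟩, hxb⟩
                exact ⟨⟨_, hc'u, hx⟩, hxb⟩
              by_cases hbc : ∃ v ∈ b, v ∈ descendants R c ∧ v ∉ descendants R c'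
              · obtain ⟨v, hv, hvc, hvc'⟩ := hbc
                refine ih (i + 1) u {c'} b (by simpa using hc'u) hub
                  ((Set.ncard_le_ncard hsub' (Set.toFinite _)).trans_lt hcard) (Or.inl ⟨?_, ?_⟩)
                · rintro v' hv' _ rfl
                  rwa [Option.mem_unique hv' hv]
                · rcases hj with ⟨hj, -⟩ | hj
                  · exact (hj v hv c hcS'.1 hvc).elim
                  · omega
              · push Not at hbc
                refine ih i u {c'} b (by simpa using hc'u) hub ?_ (Or.inr hi)
                by_cases hbc' : ∃ v ∈ b, c' ∈ descendants R v
                · obtain ⟨v, hv, hc'v⟩ := hbc'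
                  have : piece R {c'} b = ∅ := by
                    ext x
                    simp only [Set.mem_empty_iff_false, iff_false]
                    rintro ⟨⟨_, rfl, hx⟩, hxb⟩
                    exact hxb v hv (mem_descendants_trans hx hc'v)
                  rw [this]
                  simp
                · push Not at hbc'
                  have hbig : t < (piece R {c} (some c')).ncard := by
                    by_contra! hle
                    have h₁ := humax c' ⟨mem_descendants_of_rel hc'u huc, hbc', hle, hbc⟩
                    have h₂ := h.depth hc'u
                    omega
                  have hdisj : Disjoint (piece R {c'} b) (piece R {c} (some c')) := by
                    rw [Set.disjoint_left]
                    rintro x ⟨⟨_, rfl, hx⟩, -⟩ ⟨-, hx'⟩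
                    exact hx' _ rfl hx
                  have hsub'' : piece R {c} (some c') ⊆ piece R S b := by
                    rintro x ⟨⟨_, rfl, hx⟩, hx'⟩
                    refine ⟨⟨_, hcS'.1, hx⟩, fun v hv hxv => ?_⟩
                    rcases h.comparable hxv hx with h' | h'
                    · exact hx' c' rfl (mem_descendants_trans hxv (hbc v hv h'))
                    · exact hnb _ hcS' v hv h'
                  have h₁ := Set.ncard_le_ncard (Set.union_subset hsub' hsub'') (Set.toFinite _)
                  rw [Set.ncard_union_eq hdisj (Set.toFinite _) (Set.toFinite _)] at h₁
                  omega
          · refine ih i u _ b (fun c hc => hc.1) hub ?_ (Or.inr hi)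
            have := hκ' k hk
            omega
    · intro x hx hxu
      obtain ⟨c₁, hc₁, hxc₁⟩ := hcover₀ x hx
      by_cases hk : κ c₁ = 1
      · obtain rfl := hκ1 c₁ hc₁ c hcS' hk hκc
        by_cases hxu' : x ∈ descendants R u
        · obtain ⟨c', hc', hxc'⟩ := (eq_or_mem_descendants_child hxu').resolve_left hxu
          exact ⟨2, κ' c', by simpa [G] using ⟨⟨c', ⟨hc', rfl⟩, hxc'⟩, hx.2⟩⟩
        · refine ⟨1, 0, ?_⟩
          simpa [G, piece] using ⟨hxc₁, hxu'⟩
      · refine ⟨0, κ c₁, ?_⟩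
        simp only [G, hk, if_true, if_false]
        exact ⟨⟨c₁, ⟨hc₁, rfl⟩, hxc₁⟩, hx.2⟩
    · intro s k s' k' x y hx hy hxy
      rcases h.adj_iff.1 hxy with hR | hR
      · exact hcrossR hx hy hR
      · obtain ⟨h₁, h₂⟩ := hcrossR hy hx hR
        exact ⟨h₁.symm, h₂.symm⟩
    · intro k x hx hxu
      obtain ⟨c₁, hc₁, -, hne, hx'⟩ := (hG hx).elim And.right (by simp)
      rcases h.adj_iff.1 hxu with hR | hR
      · exact hne (hsib hc₁ hcS' hx' (mem_descendants_of_rel hR huc))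
      · rcases h.parent_mem huc hR with rfl | h'
        · exact haG (h.rightUnique hR hca ▸ hx)
        · exact hne (hsib hc₁ hcS' hx' h')
    · rintro k x hx ⟨v, hv, hxv⟩
      obtain ⟨-, -, hxc, hxu⟩ := (hG hx).resolve_left (by simp) |>.resolve_right (by simp)
      rcases h.adj_iff.1 hxv with hR | hR
      · have hxv' := mem_descendants_of_rel hR (mem_descendants_self v)
        rcases h.comparable hxv' hxc with h' | h'
        · exact hxu (mem_descendants_trans hxv' (hbu v hv h'))
        · exact hnb c hcS' v hv h'
      · have hvu := hbu v hv (mem_descendants_of_rel hR hxc)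
        rcases h.parent_mem hvu hR with rfl | h'
        · exact hub _ hv (mem_descendants_self _)
        · exact hxu h'
    · intro k x hx hxa
      obtain ⟨-, c', hc', -, hx'⟩ := (hG hx).resolve_left (by simp) |>.resolve_left (by simp)
      have h₁ := h.depth hc'
      have h₂ := h.depth_le hx'
      have h₃ := h.depth_le huc
      have h₄ := h.depth hca
      rcases h.adj_iff.1 hxa with hR | hR
      · have := h.depth hR
        omega
      · have := h.depth hR
        omega

end IsRooting

lemma SimpleGraph.IsTree.isRooting {V : Type*} {H : SimpleGraph V} (hH : H.IsTree) (r : V) :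
    IsRooting H (fun x y => H.Adj x y ∧ H.dist r x = H.dist r y + 1) (H.dist r) where
  rightUnique := by
    classical
    rintro x y z ⟨hxy, hy⟩ ⟨hxz, hz⟩
    obtain ⟨p, hp, hpl⟩ := (hH.connected r y).exists_path_of_dist
    obtain ⟨q, hq, hql⟩ := (hH.connected r z).exists_path_of_dist
    have hnot : ∀ {y : V} (p : H.Walk r y), H.dist r x = H.dist r y + 1 →
        p.length = H.dist r y → x ∉ p.support := fun p h₁ h₂ hx => by
      have h₃ := H.dist_le (p.takeUntil x hx)
      have h₄ := p.length_takeUntil_le_length hx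
      omega
    have h₁ := hp.concat (hnot p hy hpl) hxy.symm
    have h₂ := hq.concat (hnot q hz hql) hxz.symm
    have h₃ := (hH.existsUnique_path r x).unique h₁ h₂
    have := congrArg Walk.penultimate h₃
    simpa using this
  depth := And.right
  adj_iff := fun {x y} => by
    refine ⟨fun h => ?_, fun h => h.elim And.left fun h => h.1.symm⟩
    exact (hH.dist_eq_dist_add_one_of_adj r h).imp (⟨h, ·⟩) (⟨h.symm, ·⟩)

lemma SimpleGraph.IsTree.mem_descendants_root {V : Type*} {H : SimpleGraph V} (hH : H.IsTree)
    (r x : V) :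
    x ∈ descendants (fun x y => H.Adj x y ∧ H.dist r x = H.dist r y + 1) r := by
  obtain ⟨m, hm⟩ : ∃ m, H.dist r x = m := ⟨_, rfl⟩
  induction m generalizing x with
  | zero =>
    obtain rfl := (hH.connected.dist_eq_zero_iff).1 hm
    exact mem_descendants_self _
  | succ m ih =>
    obtain ⟨p, hp⟩ := (hH.connected x r).exists_walk_length_eq_dist
    rw [dist_comm, hm] at hp
    cases p with
    | nil => simp at hp
    | @cons _ y _ hxy p =>
      have h₁ := H.dist_le p
      rw [dist_comm] at h₁
      simp only [Walk.length_cons] at hp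
      have h₂ := hH.dist_eq_dist_add_one_of_adj r hxy
      exact mem_descendants_of_rel ⟨hxy, by omega⟩ (ih y (by omega))

/-- Every tree on at most `2 ^ j` vertices embeds into the word graph with words of length at most
`2 * j`. -/
lemma SimpleGraph.IsTree.exists_word_embedding {V : Type*} [Finite V] {H : SimpleGraph V}
    (hH : H.IsTree) {j : ℕ} (hj : Nat.card V ≤ 2 ^ j) :
    ∃ f : V → List Letter, (∀ x, (f x).length ≤ 2 * j) ∧ Function.Injective f ∧
      ∀ x y, H.Adj x y ↔ wordGraph.Adj (f x) (f y) := by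
  classical
  obtain ⟨r⟩ := hH.connected.nonempty
  set R : V → V → Prop := fun x y => H.Adj x y ∧ H.dist r x = H.dist r y + 1
  have h : IsRooting H R (H.dist r) := hH.isRooting r
  have hmem : ∀ x, x ≠ r → x ∈ piece R {c | R c r} none := fun x hx =>
    ⟨(eq_or_mem_descendants_child (hH.mem_descendants_root r x)).resolve_left hx, by simp⟩
  have hr : r ∉ piece R {c | R c r} none := by
    rintro ⟨⟨c, hc, hrc⟩, -⟩
    have h₁ := h.depth hc
    have h₂ := h.depth_le hrc
    omega
  have hcard : (piece R {c | R c r} none).ncard < 2 ^ j := by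
    refine lt_of_lt_of_le ?_ hj
    rw [← Set.ncard_univ]
    exact Set.ncard_lt_ncard (Set.ssubset_univ_iff.2 fun h' => hr (h' ▸ Set.mem_univ r))
      (Set.toFinite _)
  obtain ⟨f, h₁, h₂, h₃, h₄, -⟩ := h.embeds_piece (2 * j) j r {c | R c r} none (fun c hc => hc)
    (by simp) hcard (Or.inl ⟨by simp, le_rfl⟩) [] 2 0
  have hne : ∀ x, x ≠ r → f x ≠ [] := fun x hx h' => by
    obtain ⟨⟨g, hg⟩, -⟩ := h₁ x (hmem x hx)
    rw [h'] at hg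
    simpa using hg.length_le
  have hrx : ∀ x, x ≠ r → (H.Adj x r ↔ wordGraph.Adj (f x) []) := fun x hx =>
    (h₄ x (hmem x hx) [] rfl).symm
  refine ⟨fun x => if x = r then [] else f x, ?_, ?_, ?_⟩
  · intro x
    dsimp only
    split_ifs with hx
    · simp
    · simpa using (h₁ x (hmem x hx)).2
  · intro x y hxy
    dsimp only at hxy
    split_ifs at hxy with hx hy hy
    · rw [hx, hy]
    · exact (hne y hy hxy.symm).elim
    · exact (hne x hx hxy).elim
    · exact h₂ (hmem x hx) (hmem y hy) hxy
  · intro x y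
    dsimp only
    split_ifs with hx hy hy
    · simp [hx, hy]
    · rw [hx, H.adj_comm, wordGraph.adj_comm]
      exact hrx y hy
    · rw [hy]
      exact hrx x hx
    · exact h₃ x (hmem x hx) y (hmem y hy)

/-- There is a constant `c` such that for every `n ≥ 2` there is a graph
`U` of treewidth at most 2 (in particular `K₄`-minor-free and planar) with at most `n^c`
vertices containing every `n`-vertex tree as an induced subgraph. -/
theorem statement5 :
    ∃ c : ℕ, ∀ n : ℕ, 2 ≤ n →
      ∃ (N : ℕ) (U : SimpleGraph (Fin N)),
        HasTreewidthAtMost U 2 ∧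
        ¬ U.HasMinor (⊤ : SimpleGraph (Fin 4)) ∧
        IsPlanarW U ∧
        N ≤ n ^ c ∧
        ∀ H : SimpleGraph (Fin n), H.IsTree → ContainsInd U H := by
  refine ⟨24, fun n hn => ?_⟩
  set L := Nat.log 2 n
  have hL : 2 ^ L ≤ n := Nat.pow_log_le_self 2 (by omega)
  have hL' : n ≤ 2 ^ (L + 1) := (Nat.lt_pow_succ_log_self (by norm_num) n).le
  set d := 2 * (L + 1)
  let e : Fin (Nat.card (Words d)) ≃ Words d := (Finite.equivFin (Words d)).symm
  have he : Function.Injective fun x => (e x).1 := Subtype.val_injective.comp e.injective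
  refine ⟨Nat.card (Words d), wordGraph.comap fun x => (e x).1,
    hasTreewidthAtMost_two e fun _ _ => id, ?_, ⟨?_, ?_⟩, ?_, ?_⟩
  · exact not_hasMinor_of_three_neighbors _ he (fun _ _ => id) _ fun b =>
      ⟨b.succAbove, Fin.succAbove_right_injective, fun i => (Fin.succAbove_ne b i).symm⟩
  · refine not_hasMinor_of_three_neighbors _ he (fun _ _ => id) _ fun b =>
      ⟨fun i => b.succAbove i.castSucc, fun i j hij => ?_, fun i => (Fin.succAbove_ne b _).symm⟩
    exact Fin.castSucc_injective _ (Fin.succAbove_right_injective hij)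
  · refine not_hasMinor_of_three_neighbors _ he (fun _ _ => id) _ ?_
    rintro (b | b)
    · exact ⟨Sum.inr, Sum.inr_injective, fun i => by simp⟩
    · exact ⟨Sum.inl, Sum.inl_injective, fun i => by simp⟩
  · calc Nat.card (Words d) ≤ 64 ^ d := card_words_le d
      _ = (2 ^ L) ^ 12 * 2 ^ 12 := by
        rw [← pow_mul, ← pow_add, show (64 : ℕ) = 2 ^ 6 by norm_num, ← pow_mul]
        congr 1
        omega
      _ ≤ n ^ 12 * n ^ 12 := Nat.mul_le_mul (Nat.pow_le_pow_left hL 12) (Nat.pow_le_pow_left hn 12)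
      _ = n ^ 24 := by rw [← pow_add]
  · intro H hH
    obtain ⟨f, hlen, hinj, hadj⟩ := hH.exists_word_embedding (j := L + 1) (by simpa using hL')
    refine ⟨fun x => e.symm ⟨f x, hlen x⟩, fun x y hxy => hinj ?_, fun x y => ?_⟩
    · simpa using hxy
    · simpa using hadj x y
end

section
/- For every integer k ≥ 1 and every integer n ≥ 1 there exists a finite simple graph U of pathwidth at most k²+k−1 with at most n^{k+1} vertices that contains every n-vertex graph of pathwidth at most k as a subgraph. -/
open SimpleGraph

/-- `G` has a path-decomposition of width at most `k`. -/
def HasPathwidthAtMost {V : Type*} (G : SimpleGraph V) (k : ℕ) : Prop :=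
  ∃ (m : ℕ) (B : Fin (m + 1) → Set V),
    (∀ v, ∃ i, v ∈ B i) ∧
    (∀ u v, G.Adj u v → ∃ i, u ∈ B i ∧ v ∈ B i) ∧
    (∀ v, ∀ i j l : Fin (m + 1), i ≤ j → j ≤ l → v ∈ B i → v ∈ B l → v ∈ B j) ∧
    (∀ i, (B i).ncard ≤ k + 1)
/-- `U` contains `H` as a subgraph. -/
def ContainsSub {α β : Type*} (U : SimpleGraph β) (H : SimpleGraph α) : Prop :=
  ∃ f : α → β, Function.Injective f ∧ ∀ a b, H.Adj a b → U.Adj (f a) (f b)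

/-- The closed intervals `[l a, r a]` and `[l b, r b]` intersect. -/
def Meets {α : Type*} (l r : α → ℕ) (a b : α) : Prop := l a ≤ r b ∧ l b ≤ r a

theorem Meets.symm {α : Type*} {l r : α → ℕ} {a b : α} (h : Meets l r a b) : Meets l r b a :=
  ⟨h.2, h.1⟩

/-- Every system of at most `n` intervals with distinct left endpoints that covers each point at
most `k + 1` times embeds into the system `[L w, R w]`, preserving intersections. -/
def IsUniversalIntervals (k n : ℕ) {W : Type} (L R : W → ℕ) : Prop :=
  ∀ (α : Type) (A : Finset α) (l r : α → ℕ), A.card ≤ n → (∀ a ∈ A, l a ≤ r a) →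
    Set.InjOn l A → (∀ t, (A.filter fun a => l a ≤ t ∧ t ≤ r a).card ≤ k + 1) →
    ∃ φ : α → W, Set.InjOn φ A ∧
      ∀ a ∈ A, ∀ b ∈ A, Meets l r a b → Meets L R (φ a) (φ b)

section Blocks

variable {W : Type} {K : ℕ}

/-- Left endpoints of the system consisting of groups of `K + 1` long intervals, one group for
each `j : ℕ`, with a copy of the system `W` between consecutive groups. -/
def blockLeft (M : ℕ) (L : W → ℕ) : ℕ × (Fin (K + 1) ⊕ W) → ℕ
  | (j, Sum.inl i) => j * (M + 1) + if i = Fin.last K then M else 0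
  | (j, Sum.inr w) => (j + 1) * (M + 1) + L w

/-- Right endpoints matching `blockLeft`. -/
def blockRight (M : ℕ) (R : W → ℕ) : ℕ × (Fin (K + 1) ⊕ W) → ℕ
  | (j, Sum.inl _) => j * (M + 1) + (2 * M + 1)
  | (j, Sum.inr w) => (j + 1) * (M + 1) + R w

theorem blockLeft_succ (M : ℕ) (L : W → ℕ) (p : ℕ × (Fin (K + 1) ⊕ W)) :
    blockLeft M L (p.1 + 1, p.2) = blockLeft M L p + (M + 1) := by
  rcases p with ⟨j, i | w⟩ <;> simp only [blockLeft] <;> ring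

theorem blockRight_succ (M : ℕ) (R : W → ℕ) (p : ℕ × (Fin (K + 1) ⊕ W)) :
    blockRight M R (p.1 + 1, p.2) = blockRight M R p + (M + 1) := by
  rcases p with ⟨j, i | w⟩ <;> simp only [blockRight] <;> ring

theorem block_meets_succ {M : ℕ} {L R : W → ℕ} {p q : ℕ × (Fin (K + 1) ⊕ W)}
    (h : Meets (blockLeft M L) (blockRight M R) p q) :
    Meets (blockLeft M L) (blockRight M R) (p.1 + 1, p.2) (q.1 + 1, q.2) := by
  unfold Meets at *
  simp only [blockLeft_succ, blockRight_succ]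
  omega

theorem block_left_le_right {M : ℕ} {L R : W → ℕ} (h : ∀ w, L w ≤ R w)
    (p : ℕ × (Fin (K + 1) ⊕ W)) : blockLeft M L p ≤ blockRight M R p := by
  rcases p with ⟨j, i | w⟩
  · simp only [blockLeft, blockRight]
    split_ifs <;> omega
  · simpa only [blockLeft, blockRight, add_le_add_iff_left] using h w

theorem block_meets_group (M : ℕ) (L R : W → ℕ) (j : ℕ) (i i' : Fin (K + 1)) :
    Meets (blockLeft M L) (blockRight M R) (j, Sum.inl i) (j, Sum.inl i') := by
  simp only [Meets, blockLeft, blockRight]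
  constructor <;> split_ifs <;> omega

theorem block_meets_next_group (M : ℕ) (L R : W → ℕ) (i i' : Fin (K + 1)) :
    Meets (blockLeft M L) (blockRight M R) (0, Sum.inl i) (1, Sum.inl i') := by
  simp only [Meets, blockLeft, blockRight]
  constructor <;> split_ifs <;> omega

theorem block_meets_inner {M : ℕ} {L R : W → ℕ} (h : ∀ w, L w ≤ R w) (hM : ∀ w, R w < M)
    (i : Fin (K + 1)) (w : W) :
    Meets (blockLeft M L) (blockRight M R) (0, Sum.inl i) (0, Sum.inr w) := by
  have h1 := h w
  have h2 := hM w
  simp only [Meets, blockLeft, blockRight]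
  constructor
  · split_ifs <;> omega
  · omega

theorem block_meets_inner_next {M : ℕ} {L R : W → ℕ} (h : ∀ w, L w ≤ R w) (hM : ∀ w, R w < M)
    {i : Fin (K + 1)} (hi : i ≠ Fin.last K) (w : W) :
    Meets (blockLeft M L) (blockRight M R) (0, Sum.inr w) (1, Sum.inl i) := by
  have h1 := h w
  have h2 := hM w
  simp only [Meets, blockLeft, blockRight, if_neg hi]
  constructor <;> omega

theorem block_ncard_le [Fintype W] {M c : ℕ} {L R : W → ℕ} (hM : ∀ w, R w < M) (hc : 1 ≤ c)
    (hcard : ∀ t, {w | L w ≤ t ∧ t ≤ R w}.ncard ≤ c) (t : ℕ) :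
    {p : ℕ × (Fin (K + 1) ⊕ W) | blockLeft M L p ≤ t ∧ t ≤ blockRight M R p}.Finite ∧
    {p : ℕ × (Fin (K + 1) ⊕ W) | blockLeft M L p ≤ t ∧ t ≤ blockRight M R p}.ncard
      ≤ 2 * K + 1 + c := by
  obtain ⟨q, s, hs, rfl⟩ : ∃ q s, s < M + 1 ∧ t = q * (M + 1) + s :=
    ⟨t / (M + 1), t % (M + 1), Nat.mod_lt _ (Nat.succ_pos _), by
      rw [mul_comm]; exact (Nat.div_add_mod _ _).symm⟩
  let X₁ : Set (ℕ × (Fin (K + 1) ⊕ W)) :=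
    (fun i : Fin (K + 1) => (q - 1, Sum.inl i)) '' Set.univ
  let X₂ : Set (ℕ × (Fin (K + 1) ⊕ W)) :=
    (fun i : Fin K => (q, Sum.inl i.castSucc)) '' Set.univ
  let X₃ : Set (ℕ × (Fin (K + 1) ⊕ W)) :=
    if s = M then {(q, Sum.inl (Fin.last K))}
    else (fun w : W => (q - 1, Sum.inr w)) '' {w | L w ≤ s ∧ s ≤ R w}
  have h₁ : X₁.ncard ≤ K + 1 := (Set.ncard_image_le Set.finite_univ).trans (by simp)
  have h₂ : X₂.ncard ≤ K := (Set.ncard_image_le Set.finite_univ).trans (by simp)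
  have h₃ : X₃.ncard ≤ c := by
    simp only [X₃]
    split_ifs
    · simpa using hc
    · exact (Set.ncard_image_le (Set.toFinite _)).trans (hcard s)
  have hfin : (X₁ ∪ X₂ ∪ X₃).Finite := by
    refine ((Set.finite_univ.image _).union (Set.finite_univ.image _)).union ?_
    simp only [X₃]
    split_ifs
    · exact Set.finite_singleton _
    · exact (Set.toFinite _).image _
  have hsub : {p : ℕ × (Fin (K + 1) ⊕ W) | blockLeft M L p ≤ q * (M + 1) + s ∧
      q * (M + 1) + s ≤ blockRight M R p} ⊆ X₁ ∪ X₂ ∪ X₃ := by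
    rintro ⟨j, i | w⟩ ⟨hl, hr⟩
    · simp only [blockLeft, blockRight] at hl hr
      have hjq : j ≤ q := by
        by_contra! h
        have := Nat.mul_le_mul_right (M + 1) (show q + 1 ≤ j from h)
        rw [add_mul] at this
        omega
      have hqj : q ≤ j + 1 := by
        by_contra! h
        have := Nat.mul_le_mul_right (M + 1) (show j + 2 ≤ q from h)
        rw [add_mul] at this
        omega
      rcases (show j = q ∨ j = q - 1 by omega) with rfl | rfl
      · by_cases hi : i = Fin.last K
        · rw [if_pos hi] at hl
          have : s = M := by omega
          right
          simp [X₃, this, hi]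
        · left; right
          exact ⟨i.castPred hi, trivial, by simp⟩
      · left; left
        exact ⟨i, trivial, rfl⟩
    · simp only [blockLeft, blockRight] at hl hr
      have hw := hM w
      have hjq : j + 1 ≤ q := by
        by_contra! h
        have := Nat.mul_le_mul_right (M + 1) (show q + 1 ≤ j + 1 from h)
        rw [add_mul] at this
        omega
      have hqj : q ≤ j + 1 := by
        by_contra! h
        have := Nat.mul_le_mul_right (M + 1) (show j + 1 + 1 ≤ q from h)
        rw [add_mul (j + 1)] at this
        omega
      obtain rfl : q = j + 1 := by omega
      right
      have : s ≠ M := by omega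
      simp only [X₃, if_neg this]
      exact ⟨w, ⟨by omega, by omega⟩, by simp⟩
  refine ⟨hfin.subset hsub, (Set.ncard_le_ncard hsub hfin).trans ?_⟩
  have := Set.ncard_union_le (X₁ ∪ X₂) X₃
  have := Set.ncard_union_le X₁ X₂
  omega

/-- Assign slots in increasing order of left endpoints. -/
theorem exists_slots {α : Type} (S : Finset α) (l : α → ℕ) (hl : Set.InjOn l S)
    (hS : S.card ≤ K + 1) :
    ∃ e : α → Fin (K + 1), Set.InjOn e S ∧
      ∀ a ∈ S, e a = Fin.last K → S.card = K + 1 ∧ ∀ b ∈ S, l b ≤ l a := by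
  classical
  let rank : α → ℕ := fun a => (S.filter fun b => l b < l a).card
  have hsub : ∀ a ∈ S, (S.filter fun b => l b < l a) ⊆ S.erase a := by
    intro a _ b hb
    rw [Finset.mem_filter] at hb
    refine Finset.mem_erase.2 ⟨?_, hb.1⟩
    rintro rfl
    exact lt_irrefl _ hb.2
  have hlt : ∀ a ∈ S, rank a < K + 1 := by
    intro a ha
    have h1 := Finset.card_le_card (hsub a ha)
    have h2 := Finset.card_erase_add_one ha
    change rank a ≤ _ at h1
    omega
  have hmono : ∀ a ∈ S, ∀ b, l a < l b → rank a < rank b := by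
    intro a ha b hab
    refine Finset.card_lt_card ⟨fun c hc => ?_, fun h => ?_⟩
    · rw [Finset.mem_filter] at hc ⊢
      exact ⟨hc.1, hc.2.trans hab⟩
    · have := h (Finset.mem_filter.2 ⟨ha, hab⟩)
      exact lt_irrefl _ (Finset.mem_filter.1 this).2
  refine ⟨fun a => Fin.ofNat (K + 1) (rank a), fun a ha b hb hab => ?_, fun a ha hlast => ?_⟩
  · have h := congrArg Fin.val hab
    simp only [Fin.val_ofNat, Nat.mod_eq_of_lt (hlt a ha), Nat.mod_eq_of_lt (hlt b hb)] at h
    rcases lt_trichotomy (l a) (l b) with h' | h' | h'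
    · exact absurd h (hmono a ha b h').ne
    · exact hl ha hb h'
    · exact absurd h (hmono b hb a h').ne'
  · have h := congrArg Fin.val hlast
    simp only [Fin.val_ofNat, Nat.mod_eq_of_lt (hlt a ha), Fin.val_last] at h
    have h2 := Finset.card_erase_add_one ha
    have h1 := Finset.card_le_card (hsub a ha)
    change rank a ≤ _ at h1
    refine ⟨by omega, fun b hb => ?_⟩
    by_cases hba : b = a
    · rw [hba]
    · have heq := Finset.eq_of_subset_of_card_le (hsub a ha) (by change _ ≤ rank a; omega)
      have : b ∈ S.erase a := Finset.mem_erase.2 ⟨hba, hb⟩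
      rw [← heq, Finset.mem_filter] at this
      exact this.2.le

/-- Greedy embedding: the intervals containing `t` form the first group, the next group consists
of intervals reaching beyond the first one, and the intervals in between are covered. -/
theorem exists_block_embedding {n M : ℕ} {L R : W → ℕ} (hU : IsUniversalIntervals K n L R)
    (hLR : ∀ w, L w ≤ R w) (hM : ∀ w, R w < M) {α : Type} (l r : α → ℕ) (A : Finset α) :
    A.card ≤ n + 1 → (∀ a ∈ A, l a ≤ r a) → Set.InjOn l A →
    (∀ t, (A.filter fun a => l a ≤ t ∧ t ≤ r a).card ≤ K + 1 + 1) →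
    ∀ (t : ℕ) (e : α → Fin (K + 1)), (∃ a ∈ A, l a ≤ t) → (∀ a ∈ A, l a ≤ t → t ≤ r a) →
    Set.InjOn e (A.filter fun a => l a ≤ t) →
    ∃ φ : α → ℕ × (Fin (K + 1) ⊕ W), (∀ a ∈ A, (φ a).1 < A.card) ∧ Set.InjOn φ A ∧
      (∀ a ∈ A, ∀ b ∈ A, Meets l r a b →
        Meets (blockLeft M L) (blockRight M R) (φ a) (φ b)) ∧
      ∀ a ∈ A, l a ≤ t → φ a = (0, Sum.inl (e a)) := by
  classical
  induction A using Finset.strongInduction with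
  | H A ih =>
  intro hcard hlr hinj hmult t e hne hcont he
  obtain ⟨a₀, ha₀, ha₀t⟩ := hne
  obtain ⟨I, hI, hImax⟩ := (A.filter fun a => l a ≤ t).exists_max_image r
    ⟨a₀, Finset.mem_filter.2 ⟨ha₀, ha₀t⟩⟩
  rw [Finset.mem_filter] at hI
  obtain ⟨hIA, hIt⟩ := hI
  replace hImax : ∀ a ∈ A, l a ≤ t → r a ≤ r I := fun a ha h =>
    hImax a (Finset.mem_filter.2 ⟨ha, h⟩)
  let D := A.filter fun a => t < l a ∧ r a < r I
  let A' := A.filter fun a => t < l a ∧ r I ≤ r a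
  have hD : ∀ a, a ∈ D ↔ a ∈ A ∧ t < l a ∧ r a < r I := fun a => Finset.mem_filter
  have hA' : ∀ a, a ∈ A' ↔ a ∈ A ∧ t < l a ∧ r I ≤ r a := fun a => Finset.mem_filter
  have hDsub : D ⊂ A := ⟨Finset.filter_subset _ _, fun h => by
    have := (hD I).1 (h hIA); omega⟩
  have hAsub : A' ⊂ A := ⟨Finset.filter_subset _ _, fun h => by
    have := (hA' I).1 (h hIA); omega⟩
  have hDcard := Finset.card_lt_card hDsub
  have hAcard := Finset.card_lt_card hAsub
  obtain ⟨ψ, hψinj, hψ⟩ := hU α D l r (by omega) (fun a ha => hlr a (hDsub.1 ha))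
    (hinj.mono (by exact_mod_cast hDsub.1)) (fun x => by
      rcases (D.filter fun a => l a ≤ x ∧ x ≤ r a).eq_empty_or_nonempty with h | ⟨d, hd⟩
      · simp [h]
      · rw [Finset.mem_filter, hD] at hd
        have hIn : I ∉ D.filter fun a => l a ≤ x ∧ x ≤ r a := by
          rw [Finset.mem_filter, hD]; omega
        have := Finset.card_le_card (s := insert I (D.filter fun a => l a ≤ x ∧ x ≤ r a))
          (t := A.filter fun a => l a ≤ x ∧ x ≤ r a) (by
            refine Finset.insert_subset (Finset.mem_filter.2 ⟨hIA, by omega, by omega⟩) ?_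
            exact Finset.filter_subset_filter _ hDsub.1)
        rw [Finset.card_insert_of_notMem hIn] at this
        have := hmult x
        omega)
  obtain ⟨φ', hlt', hinj', hmeet', hgroup', hinner'⟩ :
      ∃ φ' : α → ℕ × (Fin (K + 1) ⊕ W), (∀ a ∈ A', (φ' a).1 < A'.card) ∧ Set.InjOn φ' A' ∧
      (∀ a ∈ A', ∀ b ∈ A', Meets l r a b →
        Meets (blockLeft M L) (blockRight M R) (φ' a) (φ' b)) ∧
      (∀ a ∈ A', l a ≤ r I → ∃ i, φ' a = (0, Sum.inl i)) ∧
      (∀ a ∈ A', ∀ b ∈ D, Meets l r b a → ∃ i ≠ Fin.last K, φ' a = (0, Sum.inl i)) := by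
    rcases A'.eq_empty_or_nonempty with hempty | hnon
    · exact ⟨fun _ => (0, Sum.inl 0), by simp [hempty]⟩
    obtain ⟨J, hJ, hJmin⟩ := A'.exists_min_image l hnon
    let t' := max (r I) (l J)
    have htI : r I ≤ t' := le_max_left _ _
    have htJ : l J ≤ t' := le_max_right _ _
    let S := A'.filter fun a => l a ≤ t'
    have hcont' : ∀ a ∈ A', l a ≤ t' → t' ≤ r a := fun a ha _ =>
      max_le ((hA' a).1 ha).2.2 ((hJmin a ha).trans (hlr a (hAsub.1 ha)))
    have hScard : S.card ≤ K + 1 := by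
      rcases le_or_gt (l J) (r I) with h | h
      · have ht' : t' = r I := max_eq_left h
        have hIn : I ∉ S := by
          rw [Finset.mem_filter, hA']; omega
        have := Finset.card_le_card (s := insert I S)
          (t := A.filter fun a => l a ≤ t' ∧ t' ≤ r a) (by
            refine Finset.insert_subset (Finset.mem_filter.2
              ⟨hIA, by have := hlr I hIA; omega, by omega⟩) fun a ha => ?_
            obtain ⟨ha, hat⟩ := Finset.mem_filter.1 ha
            exact Finset.mem_filter.2 ⟨hAsub.1 ha, hat, hcont' a ha hat⟩)
        rw [Finset.card_insert_of_notMem hIn] at this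
        have := hmult t'
        omega
      · have ht' : t' = l J := max_eq_right h.le
        have : S.card ≤ 1 := Finset.card_le_one.2 fun a ha b hb => by
          obtain ⟨ha, hat⟩ := Finset.mem_filter.1 ha
          obtain ⟨hb, hbt⟩ := Finset.mem_filter.1 hb
          have := hJmin a ha
          have := hJmin b hb
          exact hinj (hAsub.1 ha) (hAsub.1 hb) (by omega)
        omega
    obtain ⟨e', he', hlast⟩ := exists_slots S l
      (hinj.mono (by exact_mod_cast (Finset.filter_subset _ _).trans hAsub.1)) hScard
    obtain ⟨φ', h1, h2, h3, h4⟩ := ih A' hAsub (by omega) (fun a ha => hlr a (hAsub.1 ha))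
      (hinj.mono (by exact_mod_cast hAsub.1))
      (fun x => (Finset.card_le_card (Finset.filter_subset_filter _ hAsub.1)).trans (hmult x))
      t' e' ⟨J, hJ, htJ⟩ hcont' he'
    refine ⟨φ', h1, h2, h3, fun a ha hat => ⟨_, h4 a ha (hat.trans htI)⟩,
      fun a ha b hb hab => ?_⟩
    have hbD := (hD b).1 hb
    have hat : l a ≤ t' := by have := hab.2; omega
    refine ⟨_, fun hl => ?_, h4 a ha hat⟩
    obtain ⟨hSc, hSmax⟩ := hlast a (Finset.mem_filter.2 ⟨ha, hat⟩) hl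
    have haA := (hA' a).1 ha
    have hbb := hlr b hbD.1
    have hbS : b ∉ S := by
      rw [Finset.mem_filter, hA']; omega
    have hIS : I ∉ insert b S := by
      rw [Finset.mem_insert, Finset.mem_filter, hA']
      rintro (h | h)
      · rw [h] at hIt; omega
      · omega
    have hle := Finset.card_le_card (s := insert I (insert b S))
      (t := A.filter fun c => l c ≤ max (l a) (l b) ∧ max (l a) (l b) ≤ r c) (by
        have hab2 := hab.2
        refine Finset.insert_subset (Finset.mem_filter.2 ⟨hIA, by omega, by omega⟩)
          (Finset.insert_subset (Finset.mem_filter.2 ⟨hbD.1, by omega, by omega⟩)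
            fun c hc => ?_)
        have hca := hSmax c hc
        have hc' := (hA' c).1 (Finset.mem_filter.1 hc).1
        exact Finset.mem_filter.2 ⟨hc'.1, by omega, by omega⟩)
    rw [Finset.card_insert_of_notMem hIS, Finset.card_insert_of_notMem hbS] at hle
    have := hmult (max (l a) (l b))
    omega
  let φ : α → ℕ × (Fin (K + 1) ⊕ W) := fun a =>
    if l a ≤ t then (0, Sum.inl (e a))
    else if r a < r I then (0, Sum.inr (ψ a))
    else ((φ' a).1 + 1, (φ' a).2)
  have hφS : ∀ a, l a ≤ t → φ a = (0, Sum.inl (e a)) := fun a h => if_pos h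
  have hφD : ∀ a ∈ D, φ a = (0, Sum.inr (ψ a)) := fun a h => by
    have := (hD a).1 h
    simp only [φ]
    rw [if_neg (by omega), if_pos this.2.2]
  have hφA : ∀ a ∈ A', φ a = ((φ' a).1 + 1, (φ' a).2) := fun a h => by
    have := (hA' a).1 h
    simp only [φ]
    rw [if_neg (by omega), if_neg (by omega)]
  have hcases : ∀ a ∈ A, l a ≤ t ∨ a ∈ D ∨ a ∈ A' := by
    intro a ha
    rw [hD, hA']
    by_cases h1 : l a ≤ t
    · exact Or.inl h1
    · by_cases h2 : r a < r I
      · exact Or.inr (Or.inl ⟨ha, by omega, h2⟩)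
      · exact Or.inr (Or.inr ⟨ha, by omega, by omega⟩)
  have hSD : ∀ a b, l a ≤ t → b ∈ D →
      Meets (blockLeft M L) (blockRight M R) (φ a) (φ b) := fun a b ha hb => by
    rw [hφS a ha, hφD b hb]
    exact block_meets_inner hLR hM _ _
  have hSA : ∀ a ∈ A, ∀ b, l a ≤ t → b ∈ A' → Meets l r a b →
      Meets (blockLeft M L) (blockRight M R) (φ a) (φ b) := fun a haA b ha hb hab => by
    obtain ⟨i, hi⟩ := hgroup' b hb (hab.2.trans (hImax a haA ha))
    rw [hφS a ha, hφA b hb, hi]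
    exact block_meets_next_group M L R _ _
  have hDA : ∀ a b, a ∈ D → b ∈ A' → Meets l r a b →
      Meets (blockLeft M L) (blockRight M R) (φ a) (φ b) := fun a b ha hb hab => by
    obtain ⟨i, hne, hi⟩ := hinner' b hb a ha hab
    rw [hφD a ha, hφA b hb, hi]
    exact block_meets_inner_next hLR hM hne _
  refine ⟨φ, fun a ha => ?_, fun a ha b hb hab => ?_, fun a ha b hb hab => ?_,
    fun a _ h => hφS a h⟩
  · rcases hcases a ha with h | h | h
    · rw [hφS a h]; exact Nat.zero_lt_of_lt hAcard
    · rw [hφD a h]; exact Nat.zero_lt_of_lt hAcard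
    · rw [hφA a h]
      have := hlt' a h
      change (φ' a).1 + 1 < A.card
      omega
  · rcases hcases a ha with h | h | h <;> rcases hcases b hb with h' | h' | h'
    · rw [hφS a h, hφS b h'] at hab
      simp only [Prod.mk.injEq, Sum.inl.injEq, true_and] at hab
      exact he (by simpa using ⟨ha, h⟩) (by simpa using ⟨hb, h'⟩) hab
    · rw [hφS a h, hφD b h'] at hab; simp at hab
    · rw [hφS a h, hφA b h'] at hab; simp at hab
    · rw [hφD a h, hφS b h'] at hab; simp at hab
    · rw [hφD a h, hφD b h'] at hab
      simp only [Prod.mk.injEq, Sum.inr.injEq, true_and] at hab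
      exact hψinj h h' hab
    · rw [hφD a h, hφA b h'] at hab; simp at hab
    · rw [hφA a h, hφS b h'] at hab; simp at hab
    · rw [hφA a h, hφD b h'] at hab; simp at hab
    · rw [hφA a h, hφA b h'] at hab
      simp only [Prod.mk.injEq, add_left_inj] at hab
      exact hinj' h h' (Prod.ext hab.1 hab.2)
  · rcases hcases a ha with h | h | h <;> rcases hcases b hb with h' | h' | h'
    · rw [hφS a h, hφS b h']; exact block_meets_group M L R _ _ _
    · exact hSD a b h h'
    · exact hSA a ha b h h' hab
    · exact (hSD b a h' h).symm
    · rw [hφD a h, hφD b h']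
      have := hψ a h b h' hab
      unfold Meets at *
      simpa only [blockLeft, blockRight, add_le_add_iff_left] using this
    · exact hDA a b h h' hab
    · exact (hSA b hb a h' h hab.symm).symm
    · exact (hDA b a h' h hab.symm).symm
    · rw [hφA a h, hφA b h']
      exact block_meets_succ (hmeet' a h b h' hab)

end Blocks

theorem pow_add_le_succ_pow {m : ℕ} (hm : 1 ≤ m) (k : ℕ) : m ^ k + k ≤ (m + 1) ^ k := by
  induction k with
  | zero => simp
  | succ k ih =>
    have h1 : k + 1 ≤ (m + 1) ^ k := by
      have := Nat.one_le_pow k m hm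
      omega
    calc m ^ (k + 1) + (k + 1) ≤ m ^ k * m + (m + 1) ^ k := by rw [pow_succ]; omega
      _ ≤ (m + 1) ^ k * m + (m + 1) ^ k :=
          Nat.add_le_add_right (Nat.mul_le_mul_right _ (by omega)) _
      _ = (m + 1) ^ (k + 1) := by ring

theorem exists_universalIntervals (k n : ℕ) (hn : 1 ≤ n) :
    ∃ (W : Type) (_ : Fintype W) (L R : W → ℕ), Fintype.card W ≤ n ^ (k + 1) ∧
      (∀ w, L w ≤ R w) ∧ (∀ t, {w | L w ≤ t ∧ t ≤ R w}.ncard ≤ k ^ 2 + 1) ∧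
      IsUniversalIntervals k n L R := by
  classical
  induction k generalizing n with
  | zero =>
    refine ⟨Fin n, inferInstance, fun i => i, fun i => i, by simp, fun _ => le_rfl, fun t => ?_,
      fun α A l r hA hlr _ hmult => ?_⟩
    · refine (Set.ncard_le_one (Set.toFinite _)).2 fun a ha b hb => Fin.ext ?_
      simp only [Set.mem_ofPred_eq] at ha hb
      omega
    · obtain ⟨f, hf⟩ : ∃ f : A → Fin n, Function.Injective f :=
        ⟨_, (Fin.castLE_injective hA).comp A.equivFin.injective⟩
      refine ⟨fun a => if h : a ∈ A then f ⟨a, h⟩ else ⟨0, hn⟩, fun a ha b hb hab => ?_,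
        fun a ha b hb hab => ?_⟩
      · rw [Finset.mem_coe] at ha hb
        simp only [dif_pos ha, dif_pos hb] at hab
        exact congrArg Subtype.val (hf hab)
      · have hab' : a = b := Finset.card_le_one.1 (hmult (max (l a) (l b))) a
          (Finset.mem_filter.2 ⟨ha, le_max_left _ _, max_le (hlr a ha) hab.2⟩) b
          (Finset.mem_filter.2 ⟨hb, le_max_right _ _, max_le hab.1 (hlr b hb)⟩)
        subst hab'
        exact ⟨le_rfl, le_rfl⟩
  | succ K ih =>
    obtain ⟨m, rfl⟩ : ∃ m, n = m + 1 := ⟨n - 1, by omega⟩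
    rcases Nat.eq_zero_or_pos m with rfl | hm
    · refine ⟨Unit, inferInstance, fun _ => 0, fun _ => 0, by simp, fun _ => le_rfl,
        fun t => (Set.ncard_le_one (Set.toFinite _)).2 (fun _ _ _ _ => rfl) |>.trans (by simp),
        fun α A l r hA _ _ _ => ⟨fun _ => (), fun a ha b hb _ => ?_, ?_⟩⟩
      · exact Finset.card_le_one.1 hA a ha b hb
      · exact fun _ _ _ _ _ => ⟨le_rfl, le_rfl⟩
    obtain ⟨W, _, L, R, hW, hLR, hmul, hU⟩ := ih m hm
    obtain ⟨M, hM⟩ : ∃ M, ∀ w, R w < M :=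
      ⟨Finset.univ.sup R + 1, fun w => Nat.lt_succ_of_le (Finset.le_sup (Finset.mem_univ w))⟩
    let ι : Fin (m + 1) × (Fin (K + 1) ⊕ W) → ℕ × (Fin (K + 1) ⊕ W) := fun p => (p.1, p.2)
    have hι : Function.Injective ι := fun p q h => by
      simp only [ι, Prod.mk.injEq] at h
      exact Prod.ext (Fin.ext h.1) h.2
    refine ⟨Fin (m + 1) × (Fin (K + 1) ⊕ W), inferInstance, blockLeft M L ∘ ι,
      blockRight M R ∘ ι, ?_, fun p => block_left_le_right hLR _, fun t => ?_,
      fun α A l r hA hlr hinj hmult => ?_⟩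
    · have := pow_add_le_succ_pow hm (K + 1)
      rw [Fintype.card_prod, Fintype.card_sum, Fintype.card_fin, Fintype.card_fin, pow_succ,
        mul_comm]
      exact Nat.mul_le_mul_right _ (by omega)
    · obtain ⟨hfin, hle⟩ := block_ncard_le (K := K) hM (by omega) hmul t
      refine (Set.ncard_le_ncard_of_injOn ι (fun p hp => hp) hι.injOn hfin).trans
        (hle.trans (le_of_eq (by ring)))
    · obtain ⟨φ, h1, h2, h3⟩ : ∃ φ : α → ℕ × (Fin (K + 1) ⊕ W),
          (∀ a ∈ A, (φ a).1 < A.card) ∧ Set.InjOn φ A ∧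
          ∀ a ∈ A, ∀ b ∈ A, Meets l r a b →
            Meets (blockLeft M L) (blockRight M R) (φ a) (φ b) := by
        rcases A.eq_empty_or_nonempty with rfl | hne
        · exact ⟨fun _ => (0, Sum.inl 0), by simp⟩
        obtain ⟨J, hJ, hJmin⟩ := A.exists_min_image l hne
        obtain ⟨φ, h1, h2, h3, -⟩ := exists_block_embedding hU hLR hM l r A hA hlr hinj hmult
          (l J) (fun _ => 0) ⟨J, hJ, le_rfl⟩ (fun a ha _ => (hJmin a ha).trans (hlr a ha))
          (fun a ha b hb _ => by
            simp only [Finset.coe_filter, Set.mem_ofPred_eq] at ha hb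
            exact hinj ha.1 hb.1 ((ha.2.antisymm (hJmin a ha.1)).trans
              ((hJmin b hb.1).antisymm hb.2)))
        exact ⟨φ, h1, h2, h3⟩
      have hφ : ∀ a ∈ A, ι (Fin.ofNat (m + 1) (φ a).1, (φ a).2) = φ a := fun a ha => by
        have := h1 a ha
        simp only [ι, Fin.val_ofNat]
        rw [Nat.mod_eq_of_lt (by omega)]
      refine ⟨fun a => (Fin.ofNat (m + 1) (φ a).1, (φ a).2), fun a ha b hb hab => ?_,
        fun a ha b hb hab => ?_⟩
      · refine h2 ha hb ?_
        rw [← hφ a ha, ← hφ b hb]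
        exact congrArg ι hab
      · have := h3 a ha b hb hab
        rw [← hφ a ha, ← hφ b hb] at this
        exact this

/-- Turn a path-decomposition into an interval system with distinct left endpoints. -/
theorem HasPathwidthAtMost.exists_intervals {n k : ℕ} {H : SimpleGraph (Fin n)}
    (hH : HasPathwidthAtMost H k) :
    ∃ l r : Fin n → ℕ, (∀ v, l v ≤ r v) ∧ Function.Injective l ∧
      (∀ t, (Finset.univ.filter fun v => l v ≤ t ∧ t ≤ r v).card ≤ k + 1) ∧
      ∀ u v, H.Adj u v → Meets l r u v := by
  classical
  obtain ⟨m, B, hcov, hadj, hconv, hcard⟩ := hH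
  have hmin : ∀ v, ∃ i, v ∈ B i ∧ ∀ j, v ∈ B j → i ≤ j := fun v => by
    obtain ⟨i, hi⟩ := hcov v
    obtain ⟨x, hx, hx'⟩ := (Finset.univ.filter (v ∈ B ·)).exists_min_image id
      ⟨i, by simpa using hi⟩
    exact ⟨x, by simpa using hx, fun j hj => hx' j (by simpa using hj)⟩
  have hmax : ∀ v, ∃ i, v ∈ B i ∧ ∀ j, v ∈ B j → j ≤ i := fun v => by
    obtain ⟨i, hi⟩ := hcov v
    obtain ⟨x, hx, hx'⟩ := (Finset.univ.filter (v ∈ B ·)).exists_max_image id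
      ⟨i, by simpa using hi⟩
    exact ⟨x, by simpa using hx, fun j hj => hx' j (by simpa using hj)⟩
  choose x hx hx' using hmin
  choose y hy hy' using hmax
  have hle : ∀ u v : Fin n, x u ≤ y v → (x u : ℕ) * n + u ≤ (y v : ℕ) * n + (n - 1) :=
    fun u v h => by
      have := Nat.mul_le_mul_right n (show (x u : ℕ) ≤ y v from h)
      omega
  have hdivx : ∀ v : Fin n, ((x v : ℕ) * n + v) / n = x v := fun v => by
    have := v.2
    rw [mul_comm, Nat.mul_add_div (by omega), Nat.div_eq_of_lt this, add_zero]
  have hdivy : ∀ v : Fin n, ((y v : ℕ) * n + (n - 1)) / n = y v := fun v => by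
    have := v.2
    rw [mul_comm, Nat.mul_add_div (by omega), Nat.div_eq_of_lt (by omega), add_zero]
  refine ⟨fun v => x v * n + v, fun v => y v * n + (n - 1), fun v => hle v v (hx' v _ (hy v)),
    fun u v huv => ?_, fun t => ?_, fun u v huv => ?_⟩
  · have h : (x u : ℕ) = x v := by rw [← hdivx u, ← hdivx v]; exact congrArg (· / n) huv
    simp only [h] at huv
    exact Fin.ext (by omega)
  · have key : ∀ v : Fin n, (x v : ℕ) * n + v ≤ t ∧ t ≤ (y v : ℕ) * n + (n - 1) →
        (x v : ℕ) ≤ t / n ∧ t / n ≤ y v := fun v h =>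
      ⟨hdivx v ▸ Nat.div_le_div_right h.1, hdivy v ▸ Nat.div_le_div_right h.2⟩
    by_cases ht : t / n < m + 1
    · refine le_trans ?_ (hcard ⟨t / n, ht⟩)
      rw [← Set.ncard_coe_finset]
      refine Set.ncard_le_ncard (fun v hv => ?_) (Set.toFinite _)
      have hv := key v (by simpa using hv)
      exact hconv v (x v) _ (y v) hv.1 hv.2 (hx v) (hy v)
    · rw [Finset.filter_eq_empty_iff.2]
      · simp
      · intro v _ hv
        have := key v hv
        have := (y v).2
        omega
  · obtain ⟨i, hu, hv⟩ := hadj u v huv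
    exact ⟨hle u v ((hx' u i hu).trans (hy' v i hv)), hle v u ((hx' v i hv).trans (hy' u i hu))⟩

/-- The intersection graph of an interval system. -/
def intervalGraph {W : Type*} (L R : W → ℕ) : SimpleGraph W where
  Adj v w := v ≠ w ∧ Meets L R v w
  symm := ⟨fun _ _ h => ⟨h.1.symm, h.2.symm⟩⟩
  loopless := ⟨fun _ h => h.1 rfl⟩

theorem intervalGraph_hasPathwidthAtMost {W : Type*} [Fintype W] {L R : W → ℕ} {k : ℕ}
    (hLR : ∀ w, L w ≤ R w) (hcard : ∀ t, {w | L w ≤ t ∧ t ≤ R w}.ncard ≤ k + 1) :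
    HasPathwidthAtMost (intervalGraph L R) k := by
  have hR : ∀ w, R w < Finset.univ.sup R + 1 := fun w =>
    Nat.lt_succ_of_le (Finset.le_sup (Finset.mem_univ w))
  refine ⟨Finset.univ.sup R, fun i => {w | L w ≤ i ∧ i ≤ R w},
    fun w => ⟨⟨R w, hR w⟩, hLR w, le_rfl⟩, fun v w h => ?_,
    fun v i j l hij hjl hi hl => ⟨hi.1.trans hij, le_trans (by exact_mod_cast hjl) hl.2⟩,
    fun i => hcard i⟩
  have h1 := max_le (hLR v) h.2.2
  have h2 := max_le h.2.1 (hLR w)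
  exact ⟨⟨max (L v) (L w), h1.trans_lt (hR v)⟩, ⟨le_max_left _ _, h1⟩, ⟨le_max_right _ _, h2⟩⟩

/-- For all `k ≥ 1` and `n ≥ 1` there is a graph of pathwidth at most
`k² + k − 1` with at most `n^(k+1)` vertices containing every `n`-vertex graph of
pathwidth at most `k` as a subgraph. -/
theorem statement10 (k n : ℕ) (hk : 1 ≤ k) (hn : 1 ≤ n) :
    ∃ (N : ℕ) (U : SimpleGraph (Fin N)),
      HasPathwidthAtMost U (k ^ 2 + k - 1) ∧
      N ≤ n ^ (k + 1) ∧
      ∀ H : SimpleGraph (Fin n), HasPathwidthAtMost H k → ContainsSub U H := by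
  obtain ⟨W, _, L, R, hW, hLR, hmul, hU⟩ := exists_universalIntervals k n hn
  let ε := (Fintype.equivFin W).symm
  refine ⟨Fintype.card W, intervalGraph (L ∘ ε) (R ∘ ε),
    intervalGraph_hasPathwidthAtMost (fun w => hLR _) (fun t => ?_), hW, fun H hH => ?_⟩
  · refine (Set.ncard_le_ncard_of_injOn ε (fun w hw => hw) ε.injective.injOn
      (Set.toFinite _)).trans ((hmul t).trans ?_)
    omega
  · obtain ⟨l, r, hlr, hinj, hmult, hadj⟩ := hH.exists_intervals
    obtain ⟨φ, hφ, hmeet⟩ := hU (Fin n) Finset.univ l r (by simp) (fun a _ => hlr a)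
      hinj.injOn hmult
    have hφ' : Function.Injective φ := fun a b h => hφ (by simp) (by simp) h
    refine ⟨ε.symm ∘ φ, ε.symm.injective.comp hφ', fun a b hab =>
      ⟨fun h => hab.ne (hφ' (ε.symm.injective h)), ?_⟩⟩
    simpa [Meets] using hmeet a (Finset.mem_univ _) b (Finset.mem_univ _) (hadj a b hab)
end

section
/- For every integer k ≥ 1 and every integer n ≥ 1 there exists a finite simple graph of pathwidth at most (k²+k−1)·2^{k²+k−1} with at most 2^{k²+k−1}·n^{k+1} vertices that contains every n-vertex graph of pathwidth at most k as an induced subgraph. -/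
open SimpleGraph

open Finset in
/-- `[a v, b v)` is a family of intervals such that adjacent vertices of `G` have intersecting
intervals and every time belongs to at most `w` intervals. -/
structure IsIntervalRep {V : Type*} [Fintype V] (G : SimpleGraph V) (w : ℕ) (a b : V → ℕ) :
    Prop where
  lt : ∀ v, a v < b v
  adj : ∀ u v, G.Adj u v → a u < b v
  card_le : ∀ t, #{v | a v ≤ t ∧ t < b v} ≤ w

section IntervalRep

open Finset

variable {V W : Type*} [Fintype V] [Fintype W] {G : SimpleGraph V} {w : ℕ} {a b : V → ℕ}

theorem IsIntervalRep.mono (h : IsIntervalRep G w a b) {w' : ℕ} (hw : w ≤ w') :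
    IsIntervalRep G w' a b :=
  ⟨h.lt, h.adj, fun t => (h.card_le t).trans hw⟩

theorem IsIntervalRep.comap (h : IsIntervalRep G w a b) {f : W → V} (hf : f.Injective) :
    IsIntervalRep (G.comap f) w (a ∘ f) (b ∘ f) := by
  refine ⟨fun v => h.lt _, fun u v huv => h.adj _ _ huv, fun t => le_trans ?_ (h.card_le t)⟩
  exact card_le_card_of_injOn f (fun x hx => by simpa using hx) hf.injOn

theorem IsIntervalRep.hasPathwidthAtMost {k : ℕ} (h : IsIntervalRep G (k + 1) a b) :
    HasPathwidthAtMost G k := by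
  have hb : ∀ v, b v ≤ univ.sup b := fun v => le_sup (mem_univ v)
  refine ⟨univ.sup b, fun t => {v | a v ≤ t ∧ t < b v}, ?_, ?_, ?_, ?_⟩
  · intro v
    have := hb v
    have := h.lt v
    exact ⟨⟨a v, by omega⟩, by simp only [Set.mem_ofPred_eq]; omega⟩
  · intro u v huv
    have := hb v
    have := h.lt v
    have := h.lt u
    have := h.adj u v huv
    have := h.adj v u huv.symm
    exact ⟨⟨max (a u) (a v), by omega⟩, by simp only [Set.mem_ofPred_eq]; omega⟩
  · intro v i j l hij hjl hi hl
    simp only [Set.mem_ofPred_eq, Fin.le_def] at *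
    omega
  · intro i
    refine le_trans (le_of_eq ?_) (h.card_le i)
    rw [← Set.ncard_coe_finset]
    simp

theorem HasPathwidthAtMost.exists_isIntervalRep {k : ℕ} (h : HasPathwidthAtMost G k) :
    ∃ a b, IsIntervalRep G (k + 1) a b := by
  classical
  obtain ⟨m, B, hcov, hadj, hconv, hcard⟩ := h
  have hne : ∀ v, (univ.filter fun i => v ∈ B i).Nonempty := fun v => by
    obtain ⟨i, hi⟩ := hcov v
    exact ⟨i, by simpa using hi⟩
  set lo : V → Fin (m + 1) := fun v => (univ.filter fun i => v ∈ B i).min' (hne v)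
  set hi : V → Fin (m + 1) := fun v => (univ.filter fun i => v ∈ B i).max' (hne v)
  have hlo : ∀ v, v ∈ B (lo v) := fun v => by
    have := min'_mem _ (hne v)
    simpa using this
  have hhi : ∀ v, v ∈ B (hi v) := fun v => by
    have := max'_mem _ (hne v)
    simpa using this
  have lo_le : ∀ v i, v ∈ B i → lo v ≤ i := fun v i h => min'_le _ _ (by simpa using h)
  have le_hi : ∀ v i, v ∈ B i → i ≤ hi v := fun v i h => le_max' _ _ (by simpa using h)
  refine ⟨fun v => lo v, fun v => hi v + 1, ⟨fun v => ?_, fun u v huv => ?_, fun t => ?_⟩⟩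
  · exact Nat.lt_succ_of_le (lo_le v _ (hhi v))
  · obtain ⟨i, hu, hv⟩ := hadj u v huv
    exact Nat.lt_succ_of_le ((lo_le u _ hu).trans (le_hi v _ hv))
  · by_cases ht : t < m + 1
    · refine le_trans ?_ (hcard ⟨t, ht⟩)
      rw [← Set.ncard_coe_finset]
      refine Set.ncard_le_ncard (fun v hv => ?_) (Set.toFinite _)
      simp only [coe_filter, mem_univ, true_and, Set.mem_ofPred_eq] at hv
      exact hconv v (lo v) ⟨t, ht⟩ (hi v) hv.1 (Nat.le_of_lt_succ hv.2) (hlo v) (hhi v)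
    · rw [filter_false_of_mem]
      · simp
      · intro v _ hv
        have := (hi v).isLt
        omega

theorem IsIntervalRep.exists_injective (h : IsIntervalRep G w a b) :
    ∃ a' b', IsIntervalRep G w a' b' ∧ a'.Injective ∧ ∀ v, a' v + 1 < b' v := by
  obtain ⟨N, ι, hι, hιN⟩ : ∃ (N : ℕ) (ι : V → ℕ), ι.Injective ∧ ∀ v, ι v < N :=
    ⟨Fintype.card V, fun v => Fintype.equivFin V v,
      fun u v huv => (Fintype.equivFin V).injective (Fin.ext huv), fun v => Fin.isLt _⟩
  have key : ∀ u v, a u < b v → a u * N + ι u < b v * N := fun u v huv => by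
    have := hιN u
    have := Nat.mul_le_mul_right N (show a u + 1 ≤ b v from huv)
    linarith
  refine ⟨fun v => 2 * (a v * N + ι v), fun v => 2 * (b v * N), ⟨fun v => ?_, fun u v huv => ?_,
    fun t => ?_⟩, fun u v huv => ?_, fun v => ?_⟩
  · have := key v v (h.lt v)
    omega
  · have := key u v (h.adj u v huv)
    omega
  · refine le_trans (card_le_card fun v hv => ?_) (h.card_le (t / 2 / N))
    simp only [mem_filter, mem_univ, true_and] at hv ⊢
    have hN : 0 < N := lt_of_le_of_lt (Nat.zero_le _) (hιN v)
    rw [Nat.le_div_iff_mul_le hN, Nat.div_lt_iff_lt_mul hN]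
    omega
  · have h1 : a u * N + ι u = a v * N + ι v := by dsimp only at huv; omega
    apply hι
    have h2 := congrArg (· % N) h1
    simpa [Nat.add_mod, Nat.mod_eq_of_lt (hιN u), Nat.mod_eq_of_lt (hιN v)] using h2
  · have := key v v (h.lt v)
    dsimp only; omega

end IntervalRep

section Layering

open Finset

variable {V : Type*} [Fintype V] {G : SimpleGraph V} {K : ℕ} {a b : V → ℕ}

/-- The vertices whose interval properly crosses the time `e`. -/
def crossing (a b : V → ℕ) (e : ℕ) : Finset V := {v | a v < e ∧ e < b v}

theorem mem_crossing {e : ℕ} {v : V} : v ∈ crossing a b e ↔ a v < e ∧ e < b v := by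
  simp [crossing]

/-- `e` is a suitable time for cutting: few intervals cross it, and some interval
does unless no interval starts from `e` on. -/
def IsCut (a b : V → ℕ) (K e : ℕ) : Prop :=
  #(crossing a b e) ≤ K + 1 ∧ ((crossing a b e).Nonempty ∨ ∀ v, a v < e)

theorem exists_isCut_of_crossing_eq_empty (hinj : a.Injective) (hab : ∀ v, a v + 1 < b v) {f : ℕ}
    (hf : crossing a b f = ∅) :
    ∃ e, f ≤ e ∧ IsCut a b K e ∧ ∀ v, b v ≤ e → b v ≤ f := by
  have hf' : ∀ v, a v < f → b v ≤ f := fun v hv => by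
    by_contra hb
    have : v ∈ crossing a b f := mem_crossing.2 ⟨hv, by omega⟩
    simp [hf] at this
  by_cases hs : ∃ v, f ≤ a v
  · obtain ⟨J, hJ, hmin⟩ := exists_min_image (univ.filter fun v => f ≤ a v) a
      (by obtain ⟨v, hv⟩ := hs; exact ⟨v, by simpa using hv⟩)
    simp only [mem_filter, mem_univ, true_and] at hJ hmin
    have hJb := hab J
    refine ⟨a J + 1, by omega, ⟨?_, Or.inl ⟨J, mem_crossing.2 ⟨by omega, by omega⟩⟩⟩, ?_⟩
    · refine le_trans (card_le_one.2 ?_) (by omega)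
      have : ∀ u ∈ crossing a b (a J + 1), u = J := fun u hu => by
        rw [mem_crossing] at hu
        apply hinj
        by_cases h : f ≤ a u
        · have := hmin u h
          omega
        · have := hf' u (by omega)
          omega
      intro u hu v hv
      rw [this u hu, this v hv]
    · intro v hv
      have := hab v
      apply hf'
      by_contra h
      have := hmin v (by omega)
      omega
  · push Not at hs
    exact ⟨f, le_rfl, ⟨by simp [hf], Or.inr hs⟩, fun v hv => hv⟩

theorem exists_next_isCut (h : IsIntervalRep G (K + 2) a b) (hinj : a.Injective)
    (hab : ∀ v, a v + 1 < b v) {e : ℕ} (he : IsCut a b K e) :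
    ∃ e', e ≤ e' ∧ IsCut a b K e' ∧ (∀ v ∈ crossing a b e, b v ≤ e') ∧
      ∀ v, e ≤ a v → b v ≤ e' → ∃ I ∈ crossing a b e, b v ≤ b I := by
  classical
  by_cases hne : (crossing a b e).Nonempty
  · obtain ⟨I, hI, hmax⟩ := exists_max_image _ b hne
    have hI' := mem_crossing.1 hI
    by_cases hf : (crossing a b (b I)).Nonempty
    · refine ⟨b I, by omega, ⟨?_, Or.inl hf⟩, hmax, fun v _ hv => ⟨I, hI, hv⟩⟩
      have hIn : I ∉ crossing a b (b I) := by simp [mem_crossing]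
      have := h.card_le (b I - 1)
      have h2 : #(insert I (crossing a b (b I))) ≤ K + 2 := by
        refine le_trans (card_le_card fun v hv => ?_) this
        simp only [mem_insert, mem_crossing] at hv
        simp only [mem_filter, mem_univ, true_and]
        rcases hv with rfl | hv <;> omega
      rw [card_insert_of_notMem hIn] at h2
      omega
    · rw [not_nonempty_iff_eq_empty] at hf
      obtain ⟨e', h1, h2, h3⟩ := exists_isCut_of_crossing_eq_empty (K := K) hinj hab hf
      refine ⟨e', by omega, h2, fun v hv => (hmax v hv).trans h1, fun v _ hv => ⟨I, hI, h3 v hv⟩⟩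
  · have hall := he.2.resolve_left hne
    exact ⟨e, le_rfl, he, fun v hv => absurd ⟨v, hv⟩ hne,
      fun v hv => absurd (hall v) (by omega)⟩

theorem exists_cut_sequence (h : IsIntervalRep G (K + 2) a b) (hinj : a.Injective)
    (hab : ∀ v, a v + 1 < b v) :
    ∃ E : ℕ → ℕ, Monotone E ∧ (∀ v, E 0 < b v) ∧ (∀ v, ∃ i, a v < E i) ∧
      ∀ i, IsCut a b K (E i) ∧ (∀ v ∈ crossing a b (E i), b v ≤ E (i + 1)) ∧
        ∀ v, E i ≤ a v → b v ≤ E (i + 1) → ∃ I ∈ crossing a b (E i), b v ≤ b I := by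
  obtain ⟨e₀, -, he₀, h0⟩ := exists_isCut_of_crossing_eq_empty (K := K) (f := 0) hinj hab
    (by ext; simp [mem_crossing])
  choose next h1 h2 h3 h4 using fun (e : ℕ) (he : IsCut a b K e) =>
    exists_next_isCut h hinj hab he
  let F : ℕ → {e // IsCut a b K e} := fun i =>
    Nat.rec ⟨e₀, he₀⟩ (fun _ p => ⟨next p.1 p.2, h2 p.1 p.2⟩) i
  have hmono : Monotone fun i => (F i).1 :=
    monotone_nat_of_le_succ fun i => h1 (F i).1 (F i).2
  refine ⟨fun i => (F i).1, hmono, fun v => ?_, fun v => ?_, fun i =>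
    ⟨(F i).2, h3 (F i).1 (F i).2, h4 (F i).1 (F i).2⟩⟩
  · by_contra hv
    have := h0 v (not_lt.1 hv)
    have := hab v
    omega
  · by_contra! hv
    have hlt : ∀ i, (F i).1 < (F (i + 1)).1 := fun i => by
      obtain ⟨I, hI⟩ := (F i).2.2.resolve_right fun hall => absurd (hall v) (not_lt.2 (hv i))
      exact (mem_crossing.1 hI).2.trans_le (h3 (F i).1 (F i).2 I hI)
    have := (strictMono_nat_of_lt_succ hlt).le_apply (x := a v + 1)
    have := hv (a v + 1)
    omega

/-- The vertices of a graph of pathwidth at most `K + 1` can be arranged into layers, each of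
which consists of at most `K + 1` vertices sitting in distinct slots and a part of pathwidth
at most `K`. -/
theorem IsIntervalRep.exists_layering (h : IsIntervalRep G (K + 2) a b) :
    ∃ (idx : V → ℕ) (slot : V → Option (Fin (K + 1))),
      (∀ v, idx v < Fintype.card V) ∧
      (∀ u v j, idx u = idx v → slot u = some j → slot v = some j → u = v) ∧
      (∀ u v, G.Adj u v → slot u = none → slot v = none → idx u = idx v) ∧
      (∀ u v j, G.Adj u v → slot u = none → slot v = some j →
        idx v = idx u ∨ idx v = idx u + 1 ∧ j.val < K) ∧
      (∀ u v j j', G.Adj u v → slot u = some j → slot v = some j' → idx u ≤ idx v + 1) ∧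
      ∀ i, Fintype.card {v // slot v = none ∧ idx v = i} ≤ Fintype.card V - 1 ∧
        ∃ a' b', IsIntervalRep
          (G.comap (Subtype.val : {v // slot v = none ∧ idx v = i} → V)) (K + 1) a' b' := by
  classical
  obtain ⟨a, b, h, hinj, hab⟩ := h.exists_injective
  obtain ⟨E, hmono, hE0, hEv, hE⟩ := exists_cut_sequence h hinj hab
  have hEm : ∀ {i j}, i ≤ j → E i ≤ E j := fun hij => hmono hij
  obtain ⟨s, hs, hs'⟩ : ∃ s : V → ℕ, (∀ v, a v < E (s v)) ∧ ∀ v, ∀ m < s v, E m ≤ a v :=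
    ⟨fun v => Nat.find (hEv v), fun v => Nat.find_spec (hEv v),
      fun v m hm => not_lt.1 (Nat.find_min (hEv v) hm)⟩
  have hcard : ∀ v, E (s v) < b v →
      #{u ∈ crossing a b (E (s v)) | a u < a v} < K + 1 := fun v hv => by
    refine lt_of_lt_of_le (card_lt_card ?_) (hE (s v)).1.1
    refine filter_ssubset.2 ⟨v, mem_crossing.2 ⟨hs v, hv⟩, lt_irrefl _⟩
  let idx : V → ℕ := fun v => if E (s v) < b v then s v else s v - 1
  let slot : V → Option (Fin (K + 1)) := fun v =>
    if hv : E (s v) < b v then some ⟨_, hcard v hv⟩ else none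
  have hY : ∀ v j, slot v = some j → a v < E (idx v) ∧ E (idx v) < b v ∧
      j.val = #{u ∈ crossing a b (E (idx v)) | a u < a v} ∧ ∀ m < idx v, E m ≤ a v := by
    intro v j hj
    by_cases hv : E (s v) < b v
    · simp only [slot, hv, dif_pos, Option.some.injEq] at hj
      simp only [idx, hv, if_true]
      exact ⟨hs v, trivial, by rw [← hj], hs' v⟩
    · simp [slot, hv] at hj
  have hB : ∀ v, slot v = none → E (idx v) ≤ a v ∧ b v ≤ E (idx v + 1) := by
    intro v hj
    by_cases hv : E (s v) < b v
    · simp [slot, hv] at hj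
    · simp only [idx, hv, if_false]
      have h0 : s v ≠ 0 := fun h0 => hv (h0 ▸ hE0 v)
      rw [Nat.sub_add_cancel (Nat.pos_of_ne_zero h0)]
      exact ⟨hs' v _ (by omega), not_lt.1 hv⟩
  clear_value idx slot
  have hX : ∀ i v, a v < E i → E i < b v → b v ≤ E (i + 1) := fun i v h1 h2 =>
    (hE i).2.1 v (mem_crossing.2 ⟨h1, h2⟩)
  have hcov : ∀ v, slot v = none → ∃ I, a I < E (idx v) ∧ E (idx v) < b I ∧ b v ≤ b I := by
    intro v hv
    obtain ⟨I, hI, hI'⟩ := (hE (idx v)).2.2 v (hB v hv).1 (hB v hv).2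
    rw [mem_crossing] at hI
    exact ⟨I, hI.1, hI.2, hI'⟩
  have hne : ∀ v, ∀ i ≤ idx v, (crossing a b (E i)).Nonempty := by
    intro v i hi
    refine (hE i).1.2.elim id fun hall => ?_
    cases hv : slot v with
    | none =>
      have := hEm hi
      have := (hB v hv).1
      have := hall v
      omega
    | some j =>
      obtain ⟨h1, h2, -, h3⟩ := hY v j hv
      exact ⟨v, mem_crossing.2 ⟨hall v, (hEm hi).trans_lt h2⟩⟩
  refine ⟨idx, slot, ?_, ?_, ?_, ?_, ?_, ?_⟩
  · intro v
    have : Nonempty V := ⟨v⟩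
    choose! p hp using hne v
    have : #(range (idx v + 1)) ≤ #(univ : Finset V) := by
      refine card_le_card_of_injOn p (fun _ _ => mem_coe.2 (mem_univ _)) ?_
      have key : ∀ i j, i < j → j ≤ idx v → p i ≠ p j := fun i j hij hj hp' => by
        have h1 := mem_crossing.1 (hp i (by omega))
        have h2 := mem_crossing.1 (hp j hj)
        have h3 := hX i _ h1.1 h1.2
        have h4 : E (i + 1) ≤ E j := hEm hij
        rw [hp'] at h3
        omega
      intro i hi j hj hij
      simp only [coe_range, Set.mem_Iio] at hi hj
      by_contra hne'
      rcases Nat.lt_or_gt_of_ne hne' with hlt | hlt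
      · exact key i j hlt (by omega) hij
      · exact key j i hlt (by omega) hij.symm
    rw [card_range, card_univ] at this
    omega
  · intro u v j hidx hu hv
    have key : ∀ u v, idx u = idx v → slot u = some j → slot v = some j → ¬ a u < a v := by
      intro u v hidx hu hv hlt
      obtain ⟨h1, h2, h3, -⟩ := hY u j hu
      obtain ⟨h1', h2', h3', -⟩ := hY v j hv
      rw [hidx] at h1 h2 h3
      have : #{x ∈ crossing a b (E (idx v)) | a x < a u} <
          #{x ∈ crossing a b (E (idx v)) | a x < a v} := by
        refine card_lt_card ((ssubset_iff_of_subset ?_).2 ⟨u, ?_, ?_⟩)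
        · intro x hx
          simp only [mem_filter] at hx ⊢
          exact ⟨hx.1, hx.2.trans hlt⟩
        · exact mem_filter.2 ⟨mem_crossing.2 ⟨h1, h2⟩, hlt⟩
        · simp
      omega
    exact hinj (le_antisymm (not_lt.1 (key v u hidx.symm hv hu)) (not_lt.1 (key u v hidx hu hv)))
  · have key : ∀ u v, G.Adj u v → slot u = none → slot v = none → idx v ≤ idx u := by
      intro u v huv hu hv
      by_contra! hlt
      have h1 := hB u hu
      have h2 := hB v hv
      have h3 : E (idx u + 1) ≤ E (idx v) := hEm hlt
      have := h.adj v u huv.symm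
      omega
    exact fun u v huv hu hv => le_antisymm (key v u huv.symm hv hu) (key u v huv hu hv)
  · intro u v j huv hu hv
    have h1 := hB u hu
    obtain ⟨h2, h3, h4, h5⟩ := hY v j hv
    have h6 := h.adj u v huv
    have h7 := h.adj v u huv.symm
    have h8 := hX _ v h2 h3
    have h9 : ¬ idx v < idx u := fun hlt => by
      have : E (idx v + 1) ≤ E (idx u) := hEm hlt
      omega
    have h10 : ¬ idx u + 2 ≤ idx v := fun hlt => by
      have := h5 (idx u + 1) hlt
      omega
    by_cases heq : idx v = idx u
    · exact Or.inl heq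
    refine Or.inr ⟨by omega, ?_⟩
    have heq : idx v = idx u + 1 := by omega
    rw [heq] at h2 h3 h4
    obtain ⟨I, hI, hI', hI''⟩ := hcov u hu
    have hmE : E (idx u) ≤ E (idx u + 1) := hEm (Nat.le_succ _)
    have h11 := hX _ I hI hI'
    set S : Finset V := {x ∈ crossing a b (E (idx u + 1)) | a x < a v} with hS
    have hSm : ∀ x ∈ S, a x < a v ∧ E (idx u + 1) < b x := fun x hx => by
      simp only [hS, mem_filter, mem_crossing] at hx
      exact ⟨hx.2, hx.1.2⟩
    have hvS : v ∉ S := fun hx => absurd (hSm v hx).1 (lt_irrefl _)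
    have huS : u ∉ insert v S := by
      simp only [mem_insert, not_or]
      exact ⟨huv.ne, fun hx => by have := hSm u hx; omega⟩
    have hIS : I ∉ insert u (insert v S) := by
      simp only [mem_insert, not_or]
      refine ⟨fun hx => by rw [hx] at hI; omega, fun hx => by rw [hx] at h11; omega,
        fun hx => by have := hSm I hx; omega⟩
    have hle := h.card_le (max (a u) (a v))
    have hlt := h.lt u
    have := card_le_card (s := insert I (insert u (insert v S)))
      (t := {x | a x ≤ max (a u) (a v) ∧ max (a u) (a v) < b x}) (fun x hx => by
        simp only [mem_insert] at hx
        simp only [mem_filter, mem_univ, true_and]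
        rcases hx with rfl | rfl | rfl | hx
        · omega
        · omega
        · omega
        · have := hSm x hx
          omega)
    rw [card_insert_of_notMem hIS, card_insert_of_notMem huS, card_insert_of_notMem hvS] at this
    omega
  · intro u v j j' huv hu hv
    by_contra! hlt
    obtain ⟨h1, h2, -, h3⟩ := hY u j hu
    obtain ⟨h1', h2', -, h3'⟩ := hY v j' hv
    have := h3 _ hlt
    have := hX _ v h1' h2'
    have := h.adj u v huv
    omega
  · intro i
    constructor
    · by_cases hemp : IsEmpty {v // slot v = none ∧ idx v = i}
      · simp
      · rw [not_isEmpty_iff] at hemp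
        obtain ⟨⟨v, hv, rfl⟩⟩ := hemp
        obtain ⟨I, hI, hI', -⟩ := hcov v hv
        refine Nat.le_sub_one_of_lt (Fintype.card_subtype_lt (x := I) fun hx => ?_)
        have := (hB I hx.1).1
        rw [hx.2] at this
        omega
    · refine ⟨_, _, ⟨fun v => h.lt v, fun u v huv => h.adj u v huv, fun t => ?_⟩⟩
      set T : Finset {v // slot v = none ∧ idx v = i} := {v | a v ≤ t ∧ t < b v} with hT
      rcases T.eq_empty_or_nonempty with hemp | ⟨⟨v, hv, rfl⟩, hvT⟩
      · simp [hemp]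
      · simp only [hT, mem_filter, mem_univ, true_and] at hvT
        obtain ⟨I, hI, hI', hI''⟩ := hcov v hv
        have hB' := hB v hv
        have hIn : I ∉ T.map (Function.Embedding.subtype _) := by
          simp only [mem_map, Function.Embedding.coe_subtype, Subtype.exists, exists_and_right,
            exists_eq_right, not_exists]
          intro hx _
          have := (hB I hx.1).1
          rw [hx.2] at this
          omega
        have := card_le_card (s := insert I (T.map (Function.Embedding.subtype _)))
          (t := {x | a x ≤ t ∧ t < b x}) (fun x hx => by
            simp only [mem_insert, mem_map, Function.Embedding.coe_subtype] at hx
            simp only [mem_filter, mem_univ, true_and]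
            rcases hx with rfl | ⟨y, hy, rfl⟩
            · omega
            · simpa [hT] using hy)
        rw [card_insert_of_notMem hIn, card_map] at this
        have := h.card_le t
        omega

end Layering

section Universal

/-- A `c`-coloured graph `U` is universal if it contains, as colour-preserving induced subgraphs,
all coloured graphs on at most `n` vertices with an interval representation in which every time
belongs to at most `w` intervals. -/
def IsColoredUniversal {W Λ : Type} (U : SimpleGraph W) (c : W → Λ) (w n : ℕ) : Prop :=
  ∀ (V : Type) [Fintype V] (G : SimpleGraph V) (col : V → Λ) (a b : V → ℕ),
    Fintype.card V ≤ n → IsIntervalRep G w a b →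
      ∃ f : V → W, f.Injective ∧ (∀ u v, G.Adj u v ↔ U.Adj (f u) (f v)) ∧ ∀ v, c (f v) = col v

/-- The adjacencies of a vertex to `K + 1` slots in one layer and to the first `K` slots in
another one. -/
abbrev SlotCode (K : ℕ) : Type := (Fin (K + 1) → Bool) × (Fin K → Bool)

theorem card_slotCode (K : ℕ) : Fintype.card (SlotCode K) = 2 ^ (2 * K + 1) := by
  simp only [SlotCode, Fintype.card_prod, Fintype.card_pi, Fintype.card_bool, Finset.prod_const,
    Finset.card_univ, Fintype.card_fin, ← pow_add]
  congr 1
  omega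

variable {W Λ : Type} {K n : ℕ}

/-- The vertices of the layered graph: each of the `n` layers consists of slot vertices, which
carry a slot, a colour and a code, and a copy of `W`. -/
abbrev LayeredVertex (W Λ : Type) (K n : ℕ) : Type :=
  Fin n × (Fin (K + 1) × Λ × SlotCode K ⊕ W)

/-- The adjacencies prescribed by the first vertex. A vertex in the copy of `W` is adjacent to slot
vertices of its layer and of the next one, a slot vertex to those of the previous layer and to those
of smaller slots in its layer. -/
def layeredRel (U : SimpleGraph W) (c : W → Λ × SlotCode K) :
    LayeredVertex W Λ K n → LayeredVertex W Λ K n → Prop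
  | (i, .inr x), (i', .inr x') => i = i' ∧ U.Adj x x'
  | (i, .inr x), (i', .inl (j', _)) =>
      (i' = i ∧ (c x).2.1 j' = true) ∨
        (i'.val = i.val + 1 ∧ ∃ h : j'.val < K, (c x).2.2 ⟨j', h⟩ = true)
  | (_, .inl _), (_, .inr _) => False
  | (i, .inl (j, _, C)), (i', .inl (j', _)) =>
      (i.val = i'.val + 1 ∧ C.1 j' = true) ∨
        (i = i' ∧ j' < j ∧ ∃ h : j'.val < K, C.2 ⟨j', h⟩ = true)

/-- The layered graph on copies of `U` and slot vertices. -/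
def layeredGraph (n : ℕ) (U : SimpleGraph W) (c : W → Λ × SlotCode K) :
    SimpleGraph (LayeredVertex W Λ K n) where
  Adj x y := layeredRel U c x y ∨ layeredRel U c y x
  symm := ⟨fun _ _ h => h.symm⟩
  loopless := ⟨by rintro ⟨i, ⟨j, l, C⟩ | x⟩ <;> simp [layeredRel]⟩

/-- The colouring of the layered graph. -/
def layeredColor (c : W → Λ × SlotCode K) : LayeredVertex W Λ K n → Λ
  | (_, .inl (_, l, _)) => l
  | (_, .inr x) => (c x).1

theorem IsColoredUniversal.layeredGraph {U : SimpleGraph W} {c : W → Λ × SlotCode K}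
    (hU : IsColoredUniversal U c (K + 1) (n - 1)) :
    IsColoredUniversal (layeredGraph n U c) (layeredColor c) (K + 2) n := by
  classical
  intro V _ G col a b hn h
  obtain ⟨idx, slot, hidx, hslot, hBB, hBY, hYY, hrep⟩ := h.exists_layering
  have hidx' : ∀ v, idx v < n := fun v => (hidx v).trans_le hn
  let code : V → SlotCode K := fun v =>
    (fun j => decide (∃ u, slot u = some j ∧ G.Adj v u ∧
        if slot v = none then idx u = idx v else idx v = idx u + 1),
      fun j => decide (∃ u, slot u = some j.castSucc ∧ G.Adj v u ∧
        if slot v = none then idx u = idx v + 1 else idx u = idx v))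
  choose a' b' hrep' using fun i => (hrep i).2
  choose g hg_inj hg_adj hg_col using fun i => hU {v // slot v = none ∧ idx v = i} _
    (fun v => (col v.1, code v.1)) (a' i) (b' i) ((hrep i).1.trans (by omega)) (hrep' i)
  let f : V → LayeredVertex W Λ K n := fun v => (⟨idx v, hidx' v⟩,
    if h : slot v = none then .inr (g (idx v) ⟨v, h, rfl⟩)
    else .inl ((slot v).get (Option.isSome_iff_ne_none.2 h), col v, code v))
  have hf_inr : ∀ v (h : slot v = none),
      f v = (⟨idx v, hidx' v⟩, .inr (g (idx v) ⟨v, h, rfl⟩)) := fun v h => by simp [f, h]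
  have hf_inl : ∀ v j, slot v = some j → f v = (⟨idx v, hidx' v⟩, .inl (j, col v, code v)) :=
    fun v j h => by simp [f, h]
  have hc : ∀ v (h : slot v = none), c (g (idx v) ⟨v, h, rfl⟩) = (col v, code v) :=
    fun v h => hg_col _ _
  have hg : ∀ i u v (hu : slot u = none ∧ idx u = i) (hv : slot v = none ∧ idx v = i),
      U.Adj (g i ⟨u, hu⟩) (g i ⟨v, hv⟩) ↔ G.Adj u v := fun i u v hu hv =>
    (hg_adj i ⟨u, hu⟩ ⟨v, hv⟩).symm
  clear_value f
  have hf_inr' : ∀ i v (h : slot v = none ∧ idx v = i),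
      f v = (⟨i, h.2 ▸ hidx' v⟩, .inr (g i ⟨v, h⟩)) := by
    rintro _ v ⟨h, rfl⟩
    exact hf_inr v h
  have rel_inr_inr : ∀ u v, slot u = none → slot v = none →
      (layeredRel U c (f u) (f v) ↔ G.Adj u v) := by
    intro u v hu hv
    by_cases hi : idx u = idx v
    · rw [hf_inr' _ u ⟨hu, hi⟩, hf_inr' _ v ⟨hv, rfl⟩]
      simp only [layeredRel, true_and, hg]
    · rw [hf_inr u hu, hf_inr v hv]
      simp only [layeredRel, Fin.mk.injEq, hi, false_and, false_iff]
      exact fun huv => hi (hBB u v huv hu hv)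
  have rel_inr_inl : ∀ u v j, slot u = none → slot v = some j →
      (layeredRel U c (f u) (f v) ↔ G.Adj u v) := by
    intro u v j hu hv
    rw [hf_inr u hu, hf_inl v j hv]
    simp only [layeredRel, hc, code, hu, Fin.mk.injEq, if_true, decide_eq_true_eq]
    constructor
    · rintro (⟨hi, x, hx, hux, hi'⟩ | ⟨hi, _, x, hx, hux, hi'⟩)
      · rwa [hslot v x j (by omega) hv hx]
      · rwa [hslot v x j (by omega) hv hx]
    · intro huv
      rcases hBY u v j huv hu hv with hi | ⟨hi, hj⟩
      · exact Or.inl ⟨hi, v, hv, huv, hi⟩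
      · exact Or.inr ⟨hi, hj, v, hv, huv, hi⟩
  have rel_inl_inl : ∀ u v j j', slot u = some j → slot v = some j' →
      (layeredRel U c (f u) (f v) ↔ G.Adj u v ∧
        (idx u = idx v + 1 ∨ idx u = idx v ∧ j' < j)) := by
    intro u v j j' hu hv
    rw [hf_inl u j hu, hf_inl v j' hv]
    simp only [layeredRel, code, hu, Fin.mk.injEq, reduceCtorEq, if_false, decide_eq_true_eq]
    constructor
    · rintro (⟨hi, x, hx, hux, hi'⟩ | ⟨hi, hjj, _, x, hx, hux, hi'⟩)
      · rw [hslot v x j' (by omega) hv hx]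
        exact ⟨hux, Or.inl hi'⟩
      · obtain rfl := hslot v x j' (by omega) hv hx
        exact ⟨hux, Or.inr ⟨hi, hjj⟩⟩
    · rintro ⟨huv, hi | ⟨hi, hjj⟩⟩
      · exact Or.inl ⟨hi, v, hv, huv, hi⟩
      · have := j.isLt
        exact Or.inr ⟨hi, hjj, by omega, v, hv, huv, hi.symm⟩
  have rel_inl_inr : ∀ u v j, slot u = some j → slot v = none →
      ¬ layeredRel U c (f u) (f v) := by
    intro u v j hu hv
    rw [hf_inl u j hu, hf_inr v hv]
    exact id
  refine ⟨f, ?_, fun u v => ?_, fun v => ?_⟩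
  · intro u v huv
    cases hu : slot u <;> cases hv : slot v
    · have hi : idx u = idx v := by
        rw [hf_inr u hu, hf_inr v hv] at huv
        simpa using congrArg Prod.fst huv
      rw [hf_inr' _ u ⟨hu, hi⟩, hf_inr' _ v ⟨hv, rfl⟩] at huv
      simp only [Prod.mk.injEq, Sum.inr.injEq, true_and] at huv
      exact congrArg Subtype.val (hg_inj _ huv)
    · rw [hf_inr u hu, hf_inl v _ hv] at huv
      simp at huv
    · rw [hf_inl u _ hu, hf_inr v hv] at huv
      simp at huv
    · rw [hf_inl u _ hu, hf_inl v _ hv] at huv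
      simp only [Prod.mk.injEq, Fin.mk.injEq, Sum.inl.injEq] at huv
      obtain ⟨hi, rfl, -⟩ := huv
      exact hslot u v _ hi hu hv
  · change _ ↔ layeredRel U c (f u) (f v) ∨ layeredRel U c (f v) (f u)
    rcases hu : slot u with _ | j <;> rcases hv : slot v with _ | j'
    · rw [rel_inr_inr u v hu hv, rel_inr_inr v u hv hu, G.adj_comm v u, or_self]
    · rw [rel_inr_inl u v _ hu hv, or_iff_left (rel_inl_inr v u _ hv hu)]
    · rw [rel_inr_inl v u _ hv hu, or_iff_right (rel_inl_inr u v _ hu hv), G.adj_comm]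
    · rw [rel_inl_inl u v _ _ hu hv, rel_inl_inl v u _ _ hv hu, G.adj_comm v u, ← and_or_left]
      refine ⟨fun huv => ⟨huv, ?_⟩, And.left⟩
      have h1 := hYY u v _ _ huv hu hv
      have h2 := hYY v u _ _ huv.symm hv hu
      by_cases hi : idx u = idx v
      · rcases lt_trichotomy j j' with hjj | hjj | hjj
        · exact Or.inr (Or.inr ⟨hi.symm, hjj⟩)
        · exact absurd (hslot u v j hi hu (hjj ▸ hv)) huv.ne
        · exact Or.inl (Or.inr ⟨hi, hjj⟩)
      · omega
  · cases hv : slot v with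
    | none => rw [hf_inr v hv]; simp only [layeredColor, hc v hv]
    | some j => rw [hf_inl v j hv]; rfl

open Finset in
theorem IsIntervalRep.layeredGraph [Fintype W] [Fintype Λ] {U : SimpleGraph W}
    {c : W → Λ × SlotCode K} {w : ℕ} {a b : W → ℕ} (h : IsIntervalRep U w a b) :
    ∃ a' b', IsIntervalRep (layeredGraph n U c)
      (2 * ((K + 1) * (Fintype.card Λ * 2 ^ (2 * K + 1))) + w) a' b' := by
  classical
  obtain ⟨M, hM, hbM⟩ : ∃ M, 0 < M ∧ ∀ x, b x ≤ M :=
    ⟨univ.sup b + 1, Nat.succ_pos _, fun x => (le_sup (mem_univ x)).trans (Nat.le_succ _)⟩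
  have hmul : ∀ {i j : ℕ}, i ≤ j → i * M ≤ j * M := fun hij => Nat.mul_le_mul_right M hij
  let a' : LayeredVertex W Λ K n → ℕ
    | (i, .inl _) => (i.val - 1) * M
    | (i, .inr x) => i.val * M + a x
  let b' : LayeredVertex W Λ K n → ℕ
    | (i, .inl _) => (i.val + 1) * M
    | (i, .inr x) => i.val * M + b x
  have hrel : ∀ x y, layeredRel U c x y → a' x < b' y ∧ a' y < b' x := by
    rintro ⟨i, ⟨j, l, C⟩ | x⟩ ⟨i', ⟨j', l', C'⟩ | x'⟩ hxy
    · have h1 : i.val ≤ i'.val + 1 ∧ i'.val ≤ i.val := by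
        rcases hxy with ⟨h1, -⟩ | ⟨rfl, -⟩ <;> omega
      have h2 := hmul (show i.val - 1 ≤ i'.val by omega)
      have h3 := hmul (show i'.val - 1 ≤ i.val by omega)
      simp only [a', b', Nat.succ_mul]
      omega
    · exact hxy.elim
    · have h1 : i.val ≤ i'.val ∧ i'.val ≤ i.val + 1 := by
        rcases hxy with ⟨rfl, -⟩ | ⟨h1, -⟩ <;> omega
      have h2 := hmul (show i.val ≤ i'.val by omega)
      have h3 := hmul (show i'.val - 1 ≤ i.val by omega)
      have h4 := hbM x
      have h5 := h.lt x
      simp only [a', b', Nat.succ_mul]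
      omega
    · obtain ⟨rfl, hadj⟩ := hxy
      have h1 := h.adj _ _ hadj
      have h2 := h.adj _ _ hadj.symm
      simp only [a', b']
      omega
  refine ⟨a', b', ⟨?_, ?_, ?_⟩⟩
  · rintro ⟨i, y | x⟩
    · have := hmul (Nat.sub_le i.val 1)
      simp only [a', b', Nat.succ_mul]
      omega
    · have := h.lt x
      simp only [a', b']
      omega
  · rintro x y (hxy | hxy)
    · exact (hrel x y hxy).1
    · exact (hrel y x hxy).2
  · intro t
    have h_inl : ∀ (i : Fin n) (y : Fin (K + 1) × Λ × SlotCode K),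
        a' (i, .inl y) ≤ t ∧ t < b' (i, .inl y) → i.val = t / M ∨ i.val = t / M + 1 := by
      intro i y hy
      have h1 := (Nat.le_div_iff_mul_le hM).2 hy.1
      have h2 := (Nat.div_lt_iff_lt_mul hM).2 hy.2
      omega
    have h_inr : ∀ (i : Fin n) (x : W), a' (i, .inr x) ≤ t ∧ t < b' (i, .inr x) →
        i.val = t / M ∧ a x ≤ t % M ∧ t % M < b x := by
      intro i x hx
      have h1 : i.val * M + a x ≤ t ∧ t < i.val * M + b x := hx
      have h2 := hbM x
      have h3 : t / M = i.val := Nat.div_eq_of_lt_le (by omega) (by rw [Nat.succ_mul]; omega)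
      have h4 := Nat.div_add_mod' t M
      rw [h3] at h4
      omega
    let φ : LayeredVertex W Λ K n → (Bool × Fin (K + 1) × Λ × SlotCode K) ⊕ W
      | (i, .inl y) => .inl (decide (i.val = t / M), y)
      | (i, .inr x) => .inr x
    have hcard := card_le_card_of_injOn (s := {v | a' v ≤ t ∧ t < b' v})
      (t := (univ : Finset (Bool × Fin (K + 1) × Λ × SlotCode K)).disjSum
        {x | a x ≤ t % M ∧ t % M < b x}) φ ?_ ?_
    · rw [card_disjSum, card_univ, Fintype.card_prod, Fintype.card_prod, Fintype.card_prod,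
        card_slotCode, Fintype.card_bool, Fintype.card_fin] at hcard
      exact hcard.trans (Nat.add_le_add_left (h.card_le _) _)
    · rintro ⟨i, y | x⟩ hv
      · simp [φ]
      · simp only [coe_filter, mem_univ, true_and, Set.mem_ofPred_eq] at hv
        simpa [φ] using (h_inr i x hv).2
    · rintro ⟨i, y | x⟩ hv ⟨i', y' | x'⟩ hv' heq <;>
        simp only [coe_filter, mem_univ, true_and, Set.mem_ofPred_eq] at hv hv' <;>
        simp only [φ, Sum.inl.injEq, Sum.inr.injEq, Prod.mk.injEq, reduceCtorEq,
          decide_eq_decide] at heq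
      · obtain ⟨hi, rfl⟩ := heq
        have h1 := h_inl i y hv
        have h2 := h_inl i' y hv'
        have : i = i' := Fin.ext (by omega)
        rw [this]
      · subst heq
        have : i = i' := Fin.ext ((h_inr i x hv).1.trans (h_inr i' x hv').1.symm)
        rw [this]

theorem isColoredUniversal_bot (Λ : Type) (n : ℕ) :
    IsColoredUniversal (⊥ : SimpleGraph (Fin n × Λ)) Prod.snd 1 n := by
  intro V _ G col a b hn h
  refine ⟨fun v => (Fin.castLE hn (Fintype.equivFin V v), col v), fun u v huv => ?_,
    fun u v => ?_, fun v => rfl⟩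
  · simpa using congrArg Prod.fst huv
  · simp only [SimpleGraph.bot_adj, iff_false]
    intro huv
    have h1 := h.card_le (max (a u) (a v))
    have h2 := h.adj u v huv
    have h3 := h.adj v u huv.symm
    have h4 := h.lt u
    have h5 := h.lt v
    refine huv.ne (Finset.card_le_one.1 h1 u ?_ v ?_) <;>
      · simp only [Finset.mem_filter, Finset.mem_univ, true_and]
        omega

open Finset in
theorem isIntervalRep_bot [Fintype W] :
    ∃ a b, IsIntervalRep (⊥ : SimpleGraph W) 1 a b := by
  refine ⟨fun v => Fintype.equivFin W v, fun v => Fintype.equivFin W v + 1, ⟨fun v => ?_,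
    fun u v huv => huv.elim, fun t => card_le_one.2 fun u hu v hv => ?_⟩⟩
  · exact Nat.lt_succ_self _
  · simp only [mem_filter, mem_univ, true_and] at hu hv
    exact (Fintype.equivFin W).injective (Fin.ext (by omega))

open Finset in
/-- Layers of independent sets with a single slot each have pathwidth at most `2`. -/
theorem isIntervalRep_layeredGraph_bot [Fintype W] {c : W → Unit × SlotCode 0} :
    ∃ a b, IsIntervalRep (layeredGraph n (⊥ : SimpleGraph W) c) 3 a b := by
  classical
  obtain ⟨N, ι, hι, hιN⟩ : ∃ (N : ℕ) (ι : W → ℕ), ι.Injective ∧ ∀ v, ι v < N :=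
    ⟨Fintype.card W, fun v => Fintype.equivFin W v,
      fun u v huv => (Fintype.equivFin W).injective (Fin.ext huv), fun v => Fin.isLt _⟩
  have hmul : ∀ {i j : ℕ}, i ≤ j → i * (N + 1) ≤ j * (N + 1) :=
    fun hij => Nat.mul_le_mul_right _ hij
  let a : LayeredVertex W Unit 0 n → ℕ
    | (i, .inl (_, _, C)) => i.val * (N + 1) - if C.1 0 = true then 1 else 0
    | (i, .inr x) => i.val * (N + 1) + ι x
  let b : LayeredVertex W Unit 0 n → ℕ
    | (i, .inl _) => (i.val + 1) * (N + 1)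
    | (i, .inr x) => i.val * (N + 1) + ι x + 1
  have hrel : ∀ x y, layeredRel (⊥ : SimpleGraph W) c x y → a x < b y ∧ a y < b x := by
    rintro ⟨i, ⟨j, l, C⟩ | x⟩ ⟨i', ⟨j', l', C'⟩ | x'⟩ hxy
    · rcases hxy with ⟨h1, h2⟩ | ⟨-, h1, -⟩
      · rw [show j' = 0 from Fin.eq_zero j'] at h2
        simp only [a, b, h1, h2, if_true, Nat.succ_mul]
        split_ifs <;> omega
      · omega
    · exact hxy.elim
    · rcases hxy with ⟨rfl, -⟩ | ⟨-, h1, -⟩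
      · have := hιN x
        simp only [a, b, Nat.succ_mul]
        split_ifs <;> omega
      · omega
    · exact hxy.2.elim
  refine ⟨a, b, ⟨?_, ?_, ?_⟩⟩
  · rintro ⟨i, y | x⟩
    · simp only [a, b, Nat.succ_mul]
      omega
    · simp only [a, b]
      omega
  · rintro x y (hxy | hxy)
    · exact (hrel x y hxy).1
    · exact (hrel y x hxy).2
  · intro t
    set q := t / (N + 1) with hq
    have hdm := Nat.div_add_mod' t (N + 1)
    have hr : t % (N + 1) < N + 1 := Nat.mod_lt t (Nat.succ_pos N)
    rw [← hq] at hdm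
    have h_inl : ∀ (i : Fin n) (y : Fin 1 × Unit × SlotCode 0),
        a (i, .inl y) ≤ t ∧ t < b (i, .inl y) →
          i.val = q ∨ (i.val = q + 1 ∧ t % (N + 1) = N ∧ y.2.2.1 0 = true) := by
      rintro i ⟨j, l, C⟩ ⟨h1, h2⟩
      simp only [a, b] at h1 h2
      have h3 : q < i.val + 1 := (Nat.div_lt_iff_lt_mul (Nat.succ_pos N)).2 h2
      by_cases h4 : i.val = q
      · exact Or.inl h4
      have h5 := hmul (show q + 1 ≤ i.val by omega)
      have h6 : ¬ q + 2 ≤ i.val := fun h6 => by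
        have := hmul h6
        have : (q + 2) * (N + 1) = q * (N + 1) + 2 * (N + 1) := by ring
        split_ifs at h1 <;> omega
      have h7 : i.val = q + 1 := by omega
      have h8 : (q + 1) * (N + 1) = q * (N + 1) + (N + 1) := by ring
      rw [h7, h8] at h1
      split_ifs at h1 with hC
      · exact Or.inr ⟨h7, by omega, hC⟩
      · omega
    have h_inr : ∀ (i : Fin n) (x : W), a (i, .inr x) ≤ t ∧ t < b (i, .inr x) →
        i.val = q ∧ t % (N + 1) = ι x := by
      intro i x hx
      have h1 : i.val * (N + 1) + ι x ≤ t ∧ t < i.val * (N + 1) + ι x + 1 := hx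
      have h2 := hιN x
      have h3 : q = i.val := Nat.div_eq_of_lt_le (by omega) (by rw [Nat.succ_mul]; omega)
      rw [h3] at hdm
      omega
    let φ : LayeredVertex W Unit 0 n → Option Bool
      | (i, .inl (_, _, C)) => if i.val = q then some (C.1 0) else none
      | (i, .inr x) => none
    have hcard := card_le_card_of_injOn (s := {v | a v ≤ t ∧ t < b v})
      (t := (univ : Finset (Option Bool))) φ (fun _ _ => mem_coe.2 (mem_univ _)) ?_
    · simpa using hcard
    · have hext : ∀ y y' : Fin 1 × Unit × SlotCode 0, y.2.2.1 0 = y'.2.2.1 0 → y = y' := by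
        rintro ⟨j, l, C, D⟩ ⟨j', l', C', D'⟩ hC
        have : C = C' := funext fun i => by rw [show i = 0 from Fin.eq_zero i]; exact hC
        rw [Fin.eq_zero j, Fin.eq_zero j', this, Subsingleton.elim D D']
      rintro ⟨i, y | x⟩ hv ⟨i', y' | x'⟩ hv' heq <;>
        simp only [coe_filter, mem_univ, true_and, Set.mem_ofPred_eq] at hv hv'
      · have h1 := h_inl i y hv
        have h2 := h_inl i' y' hv'
        simp only [φ] at heq
        split_ifs at heq with hi hi' hi'
        · rw [hext y y' (Option.some.inj heq), Fin.ext (hi.trans hi'.symm)]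
        · have h1 := h1.resolve_left hi
          have h2 := h2.resolve_left hi'
          rw [hext y y' (h1.2.2.trans h2.2.2.symm), Fin.ext (h1.1.trans h2.1.symm)]
      · have h1 := h_inl i y hv
        have h2 := h_inr i' x' hv'
        have := hιN x'
        simp only [φ] at heq
        split_ifs at heq with hi
        have h1 := h1.resolve_left hi
        omega
      · have h1 := h_inl i' y' hv'
        have h2 := h_inr i x hv
        have := hιN x
        simp only [φ] at heq
        split_ifs at heq with hi
        have h1 := h1.resolve_left hi
        omega
      · have h1 := h_inr i x hv
        have h2 := h_inr i' x' hv'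
        rw [hι (h1.2.symm.trans h2.2), Fin.ext (h1.1.trans h2.1.symm)]

theorem pow_add_mul_pow_le_succ_pow (m K : ℕ) :
    m ^ (K + 1) + (K + 1) * m ^ K ≤ (m + 1) ^ (K + 1) := by
  induction K with
  | zero => simp
  | succ K ih =>
    calc m ^ (K + 2) + (K + 1 + 1) * m ^ (K + 1)
        ≤ (m ^ (K + 1) + (K + 1) * m ^ K) * (m + 1) := by
          have : 0 ≤ (K + 1) * m ^ K := Nat.zero_le _
          ring_nf
          ring_nf at this
          nlinarith [this]
      _ ≤ (m + 1) ^ (K + 2) := by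
          rw [pow_succ (m + 1) (K + 1)]
          exact Nat.mul_le_mul_right _ ih

theorem succ_add_mul_pred_pow_le (K : ℕ) {n : ℕ} (hn : 1 ≤ n) :
    K + 1 + 2 ^ K ^ 2 * (n - 1) ^ (K + 1) ≤ 2 ^ K ^ 2 * n ^ (K + 1) := by
  obtain ⟨m, rfl⟩ := Nat.exists_eq_add_of_le' hn
  rw [Nat.add_sub_cancel]
  rcases Nat.eq_zero_or_pos m with rfl | hm
  · have h1 : K < 2 ^ K := Nat.lt_two_pow_self
    have h2 : 2 ^ K ≤ 2 ^ K ^ 2 := Nat.pow_le_pow_right two_pos (Nat.le_self_pow two_ne_zero K)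
    simpa using h1.trans_le h2
  · have h1 := Nat.mul_le_mul_left (2 ^ K ^ 2) (pow_add_mul_pow_le_succ_pow m K)
    have h2 : 1 * ((K + 1) * 1) ≤ 2 ^ K ^ 2 * ((K + 1) * m ^ K) :=
      Nat.mul_le_mul Nat.one_le_two_pow
        (Nat.mul_le_mul_left _ (Nat.one_le_pow _ _ hm))
    rw [mul_add] at h1
    omega

theorem card_layeredVertex_le [Fintype W] [Fintype Λ]
    (hW : Fintype.card W ≤
      2 ^ K ^ 2 * (n - 1) ^ (K + 1) * Fintype.card (Λ × SlotCode K)) :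
    Fintype.card (LayeredVertex W Λ K n) ≤
      2 ^ (K + 1) ^ 2 * n ^ (K + 2) * Fintype.card Λ := by
  rcases Nat.eq_zero_or_pos n with rfl | hn
  · simp [LayeredVertex]
  rw [Fintype.card_prod, card_slotCode] at hW
  rw [Fintype.card_prod, Fintype.card_sum, Fintype.card_prod, Fintype.card_prod, card_slotCode,
    Fintype.card_fin, Fintype.card_fin]
  calc n * ((K + 1) * (Fintype.card Λ * 2 ^ (2 * K + 1)) + Fintype.card W)
      ≤ n * ((K + 1) * (Fintype.card Λ * 2 ^ (2 * K + 1)) +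
          2 ^ K ^ 2 * (n - 1) ^ (K + 1) * (Fintype.card Λ * 2 ^ (2 * K + 1))) := by gcongr
    _ = (K + 1 + 2 ^ K ^ 2 * (n - 1) ^ (K + 1)) * (n * Fintype.card Λ * 2 ^ (2 * K + 1)) := by
        ring
    _ ≤ 2 ^ K ^ 2 * n ^ (K + 1) * (n * Fintype.card Λ * 2 ^ (2 * K + 1)) :=
        Nat.mul_le_mul_right _ (succ_add_mul_pred_pow_le K hn)
    _ = _ := by
        rw [show (K + 1) ^ 2 = K ^ 2 + (2 * K + 1) by ring, pow_add 2]
        ring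

theorem exists_isColoredUniversal (k : ℕ) : ∀ (n : ℕ) (Λ : Type) [Fintype Λ],
    ∃ (W : Type) (_ : Fintype W) (U : SimpleGraph W) (c : W → Λ),
      Fintype.card W ≤ 2 ^ k ^ 2 * n ^ (k + 1) * Fintype.card Λ ∧
      (∃ a b, IsIntervalRep U (Fintype.card Λ * ((k ^ 2 + k) * 2 ^ k ^ 2) + 1) a b) ∧
      IsColoredUniversal U c (k + 1) n := by
  induction k with
  | zero =>
    intro n Λ _
    obtain ⟨a, b, h⟩ := isIntervalRep_bot (W := Fin n × Λ)
    exact ⟨Fin n × Λ, inferInstance, ⊥, Prod.snd, by simp, ⟨a, b, h.mono (by simp)⟩,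
      isColoredUniversal_bot Λ n⟩
  | succ K ih =>
    intro n Λ _
    obtain ⟨W, _, U, c, hcard, ⟨a, b, hrep⟩, hU⟩ := ih (n - 1) (Λ × SlotCode K)
    obtain ⟨a', b', hrep'⟩ := hrep.layeredGraph (n := n) (c := c)
    refine ⟨LayeredVertex W Λ K n, inferInstance, layeredGraph n U c, layeredColor c,
      card_layeredVertex_le hcard, ⟨a', b', hrep'.mono ?_⟩, hU.layeredGraph⟩
    rw [Fintype.card_prod, card_slotCode, ← add_assoc]
    refine Nat.succ_le_succ ?_
    have h1 : 1 ≤ 2 ^ K ^ 2 := Nat.one_le_two_pow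
    calc _ = Fintype.card Λ * 2 ^ (2 * K + 1) *
          (2 * (K + 1) * 1 + (K ^ 2 + K) * 2 ^ K ^ 2) := by ring
      _ ≤ Fintype.card Λ * 2 ^ (2 * K + 1) *
          (2 * (K + 1) * 2 ^ K ^ 2 + (K ^ 2 + K) * 2 ^ K ^ 2) := by gcongr
      _ = _ := by
        rw [show (K + 1) ^ 2 = K ^ 2 + (2 * K + 1) by ring, pow_add 2]
        ring

theorem exists_isColoredUniversal_unit {k n : ℕ} (hk : 1 ≤ k) :
    ∃ (W : Type) (_ : Fintype W) (U : SimpleGraph W) (c : W → Unit),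
      Fintype.card W ≤ 2 ^ (k ^ 2 + k - 1) * n ^ (k + 1) ∧
      (∃ a b, IsIntervalRep U ((k ^ 2 + k - 1) * 2 ^ (k ^ 2 + k - 1) + 1) a b) ∧
      IsColoredUniversal U c (k + 1) n := by
  rcases hk.eq_or_lt with rfl | hk
  · obtain ⟨a, b, h⟩ := isIntervalRep_layeredGraph_bot (n := n)
      (c := (Prod.snd : Fin (n - 1) × (Unit × SlotCode 0) → _))
    refine ⟨_, inferInstance, _, _, ?_, ⟨a, b, h⟩, (isColoredUniversal_bot _ _).layeredGraph⟩
    refine (card_layeredVertex_le (by simp)).trans (by simp)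
  · obtain ⟨W, i, U, c, hcard, ⟨a, b, h⟩, hU⟩ := exists_isColoredUniversal k n Unit
    obtain ⟨m, rfl⟩ := Nat.exists_eq_add_of_le' (show 2 ≤ k from hk)
    simp only [Fintype.card_unit, mul_one, one_mul] at hcard h
    have hexp : (m + 2) ^ 2 + (m + 2) - 1 = (m + 2) ^ 2 + (m + 1) := by omega
    rw [hexp]
    refine ⟨W, i, U, c, hcard.trans ?_, ⟨a, b, h.mono (Nat.succ_le_succ ?_)⟩, hU⟩
    · gcongr
      · exact one_le_two
      · omega
    · have h1 : 1 ≤ 2 ^ m := Nat.one_le_two_pow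
      calc ((m + 2) ^ 2 + (m + 2)) * 2 ^ (m + 2) ^ 2
          ≤ ((m + 2) ^ 2 + (m + 1)) * (2 * 2 ^ m) * 2 ^ (m + 2) ^ 2 := by
            gcongr
            nlinarith
        _ = _ := by
            rw [pow_add 2 _ (m + 1), pow_succ 2 m]
            ring

end Universal

/-- For all `k ≥ 1` and `n ≥ 1` there is a graph of pathwidth at most
`(k² + k − 1) · 2^(k² + k − 1)` with at most `2^(k² + k − 1) · n^(k+1)` vertices containing
every `n`-vertex graph of pathwidth at most `k` as an induced subgraph. -/
theorem statement11 (k n : ℕ) (hk : 1 ≤ k) (hn : 1 ≤ n) :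
    ∃ (N : ℕ) (U : SimpleGraph (Fin N)),
      HasPathwidthAtMost U ((k ^ 2 + k - 1) * 2 ^ (k ^ 2 + k - 1)) ∧
      N ≤ 2 ^ (k ^ 2 + k - 1) * n ^ (k + 1) ∧
      ∀ H : SimpleGraph (Fin n), HasPathwidthAtMost H k → ContainsInd U H := by
  obtain ⟨W, _, U, c, hcard, ⟨a, b, hrep⟩, hU⟩ := exists_isColoredUniversal_unit (n := n) hk
  let e := Fintype.equivFin W
  refine ⟨Fintype.card W, U.comap e.symm, (hrep.comap e.symm.injective).hasPathwidthAtMost,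
    hcard, fun H hH => ?_⟩
  obtain ⟨a', b', h⟩ := hH.exists_isIntervalRep
  obtain ⟨f, hf, hadj, -⟩ := hU (Fin n) H (fun _ => ()) a' b' (Fintype.card_fin n).le h
  exact ⟨e ∘ f, e.injective.comp hf, fun u v => by simp [hadj]⟩
end
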